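/- There exists an absolute constant C > 0 with the following property. Let F be a field and let A ⊆ F² be a finite set; if F has positive characteristic p > 0, assume |A| ≤ p^{4/3}. Then the number of non-degenerate isosceles triangles satisfies T*(A) ≤ C·|A|^{7/3}. -/

import Mathlib

namespace Stmt5

/-- The (algebraic) squared distance in the plane `F²`. -/
def dist2 {F : Type*} [CommRing F] (x y : F × F) : F :=
  (x.1 - y.1) ^ 2 + (x.2 - y.2) ^ 2

/-- The dot product on `F²`. -/
def dot {F : Type*} [CommRing F] (x y : F × F) : F :=
  x.1 * y.1 + x.2 * y.2

/-- `T*(A)`: the number of non-degenerate isosceles triangles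
`(a,b,c) ∈ A³` with `d(a,b) = d(a,c)` and `(b-c)·(b-c) ≠ 0`. -/
noncomputable def Tstar {F : Type*} [CommRing F] (A : Finset (F × F)) : ℕ :=
  Set.ncard {t : (F × F) × (F × F) × (F × F) |
    t.1 ∈ A ∧ t.2.1 ∈ A ∧ t.2.2 ∈ A ∧
    dist2 t.1 t.2.1 = dist2 t.1 t.2.2 ∧
    dot (t.2.1 - t.2.2) (t.2.1 - t.2.2) ≠ 0}

section LinesInSpace

open MvPolynomial

section Dimension
variable (K : Type*) [Field K]

theorem card_exponents (m : ℕ) :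
    6 * Nat.card {n : Fin 3 →₀ ℕ | (n.sum fun _ e => e) ≤ m} = (m + 1) * (m + 2) * (m + 3) := by
  have h : {n : Fin 3 →₀ ℕ | (n.sum fun _ e => e) ≤ m} =
      ((Finset.range (m + 1)).biUnion fun j => (Finset.univ : Finset (Fin 3)).finsuppAntidiag j :
        Finset (Fin 3 →₀ ℕ)) := by
    ext n
    simp only [Set.mem_ofPred_eq, Finset.coe_biUnion, Set.mem_iUnion, Finset.mem_coe,
      Finset.mem_finsuppAntidiag, Finset.mem_range, Finset.subset_univ, and_true, exists_prop]
    rw [Finsupp.sum_fintype _ _ (by simp)]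
    constructor
    · intro h
      exact ⟨_, Nat.lt_succ_of_le h, rfl⟩
    · rintro ⟨j, hj, rfl⟩
      exact Nat.le_of_lt_succ hj
  have hcard : Nat.card {n : Fin 3 →₀ ℕ | (n.sum fun _ e => e) ≤ m} =
      ∑ j ∈ Finset.range (m + 1), (j + 2).choose j := by
    rw [h, Nat.card_eq_card_toFinset, Finset.toFinset_coe, Finset.card_biUnion]
    · refine Finset.sum_congr rfl fun j _ => ?_
      rw [Finset.card_finsuppAntidiag_nat_eq_choose]
      simp only [Finset.card_univ, Fintype.card_fin]
      congr 1
      omega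
    · intro i _ j _ hij
      rw [Function.onFun, Finset.disjoint_left]
      intro n hn hn'
      rw [Finset.mem_finsuppAntidiag] at hn hn'
      exact hij (hn.1.symm.trans hn'.1)
  rw [hcard]
  clear hcard h
  have hc : ∀ j : ℕ, 2 * (j + 2).choose j = (j + 1) * (j + 2) := by
    intro j
    have h1 : (j + 2).choose j = (j + 2).choose 2 := by
      rw [← Nat.choose_symm_of_eq_add (show j + 2 = j + 2 from rfl)]
    rw [h1, Nat.choose_two_right]
    have h2 : 2 ∣ (j + 2) * (j + 2 - 1) := (Nat.even_mul_pred_self _).two_dvd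
    rw [Nat.mul_div_cancel' h2, show j + 2 - 1 = j + 1 by omega, mul_comm]
  induction m with
  | zero => simp
  | succ m ih =>
    rw [Finset.sum_range_succ, mul_add, ih]
    have := hc (m + 1)
    linarith

theorem finrank_restrictTotalDegree (m : ℕ) :
    6 * Module.finrank K (restrictTotalDegree (Fin 3) K m) = (m + 1) * (m + 2) * (m + 3) := by
  rw [← card_exponents]
  congr 1
  exact Module.finrank_eq_nat_card_basis (basisRestrictSupport K _)

end Dimension

/-- A line `t ↦ (t, c + s t, d + s² t)` in three-space. -/
@[ext]
structure NullLine (K : Type*) where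
  slope : K
  c : K
  d : K

namespace NullLine
variable {K : Type*} [Field K]

/-- The point of the line with first coordinate `t`. -/
def pt (l : NullLine K) (t : K) : Fin 3 → K :=
  ![t, l.c + l.slope * t, l.d + l.slope ^ 2 * t]

/-- Restriction of a polynomial to a line. -/
noncomputable def res (l : NullLine K) : MvPolynomial (Fin 3) K →ₐ[K] Polynomial K :=
  aeval ![Polynomial.X, Polynomial.C l.c + Polynomial.C l.slope * Polynomial.X,
    Polynomial.C l.d + Polynomial.C (l.slope ^ 2) * Polynomial.X]

/-- Two lines are incident when they are concurrent or parallel in a null plane. -/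
def Inc (l l' : NullLine K) : Prop :=
  l.d - l'.d = (l.slope + l'.slope) * (l.c - l'.c)

theorem Inc.symm {l l' : NullLine K} (h : l.Inc l') : l'.Inc l := by
  unfold Inc at *
  linear_combination -h

theorem eval_res (l : NullLine K) (f : MvPolynomial (Fin 3) K) (t : K) :
    (l.res f).eval t = eval (l.pt t) f := by
  induction f using MvPolynomial.induction_on with
  | C a => simp [res]
  | add p q hp hq => simp [hp, hq]
  | mul_X p i hp =>
    rw [map_mul, map_mul, Polynomial.eval_mul, hp]
    congr 1
    fin_cases i <;> simp [res, pt]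

theorem natDegree_res_le (l : NullLine K) (f : MvPolynomial (Fin 3) K) :
    (l.res f).natDegree ≤ f.totalDegree := by
  have hX : ∀ i, ((![Polynomial.X, Polynomial.C l.c + Polynomial.C l.slope * Polynomial.X,
      Polynomial.C l.d + Polynomial.C (l.slope ^ 2) * Polynomial.X] :
        Fin 3 → Polynomial K) i).natDegree ≤ 1 := by
    intro i
    fin_cases i <;> simp <;> compute_degree
  rw [res, aeval_def, eval₂_eq]
  refine Polynomial.natDegree_sum_le_of_forall_le _ _ fun m hm => ?_
  refine (Polynomial.natDegree_C_mul_le _ _).trans ?_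
  refine (Polynomial.natDegree_prod_le _ _).trans ?_
  refine le_trans ?_ (le_totalDegree hm)
  rw [Finsupp.sum]
  refine Finset.sum_le_sum fun i _ => ?_
  exact (Polynomial.natDegree_pow_le).trans (by nlinarith [hX i])

theorem derivative_res (l : NullLine K) (f : MvPolynomial (Fin 3) K) :
    (l.res f).derivative = l.res (pderiv 0 f) + Polynomial.C l.slope * l.res (pderiv 1 f) +
      Polynomial.C (l.slope ^ 2) * l.res (pderiv 2 f) := by
  induction f using MvPolynomial.induction_on with
  | C a => simp [res]
  | add p q hp hq => simp only [map_add, hp, hq]; ring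
  | mul_X p i hp =>
    simp only [map_mul, Polynomial.derivative_mul, hp, Derivation.leibniz, smul_eq_mul, map_add]
    fin_cases i <;> simp [res, pderiv_X, Polynomial.derivative_pow] <;> ring

theorem res_eq_zero_of_roots (l : NullLine K) {f : MvPolynomial (Fin 3) K} (T : Finset K)
    (hT : f.totalDegree < T.card) (h : ∀ t ∈ T, eval (l.pt t) f = 0) : l.res f = 0 := by
  classical
  by_contra hne
  have h1 : T ⊆ (l.res f).roots.toFinset := by
    intro t ht
    simp [hne, Polynomial.IsRoot, eval_res, h t ht]
  have h2 := (Finset.card_le_card h1).trans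
    ((Multiset.toFinset_card_le _).trans (Polynomial.card_roots' _))
  have := l.natDegree_res_le f
  omega

theorem inc_of_pt_eq {l l' : NullLine K} {t : K} (h : l.pt t = l'.pt t) : l.Inc l' := by
  have h1 := congrFun h 1
  have h2 := congrFun h 2
  simp only [pt, Matrix.cons_val_one, Matrix.cons_val_two, Matrix.cons_val_zero,
    Matrix.tail_cons, Matrix.head_cons] at h1 h2
  unfold Inc
  linear_combination h2 - (l.slope + l'.slope) * h1

theorem eq_of_pt_eq {l l' : NullLine K} {t t' : K} (h : t ≠ t') (ht : l.pt t = l'.pt t)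
    (ht' : l.pt t' = l'.pt t') : l = l' := by
  have h1 := congrFun ht 1
  have h2 := congrFun ht 2
  have h1' := congrFun ht' 1
  have h2' := congrFun ht' 2
  simp only [pt, Matrix.cons_val_one, Matrix.cons_val_two, Matrix.cons_val_zero,
    Matrix.tail_cons, Matrix.head_cons] at h1 h2 h1' h2'
  have hs : l.slope = l'.slope := by
    have : (l.slope - l'.slope) * (t - t') = 0 := by linear_combination h1 - h1'
    rcases mul_eq_zero.1 this with h0 | h0
    · exact sub_eq_zero.1 h0
    · exact absurd (sub_eq_zero.1 h0) h
  rw [hs] at h1 h2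
  exact NullLine.ext hs (by simpa using h1) (by simpa using h2)

/-- First coordinate of the crossing point of two incident lines. -/
noncomputable def cross (l l' : NullLine K) : K := -(l.c - l'.c) / (l.slope - l'.slope)

theorem cross_comm (l l' : NullLine K) : l.cross l' = l'.cross l := by
  unfold cross
  rw [← neg_sub l'.c l.c, ← neg_sub l'.slope l.slope, neg_neg, div_neg, neg_div]

theorem Inc.pt_cross {l l' : NullLine K} (h : l.Inc l') (hs : l.slope ≠ l'.slope) :
    l.pt (l.cross l') = l'.pt (l.cross l') := by
  have hs' : l.slope - l'.slope ≠ 0 := sub_ne_zero.2 hs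
  have h1 : l.c + l.slope * l.cross l' = l'.c + l'.slope * l.cross l' := by
    unfold cross; field_simp; ring
  have h2 : l.d + l.slope ^ 2 * l.cross l' = l'.d + l'.slope ^ 2 * l.cross l' := by
    unfold Inc at h
    linear_combination h + (l.slope + l'.slope) * h1
  simp only [pt, h1, h2]

theorem cross_injOn (l : NullLine K) {S : Finset (NullLine K)}
    (hinc : ∀ x ∈ S, x.Inc l ∧ x.slope ≠ l.slope)
    (hskew : ∀ x ∈ S, ∀ y ∈ S, x ≠ y → ¬ x.Inc y) :
    Set.InjOn (fun x : NullLine K => x.cross l) (S : Set (NullLine K)) := by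
  intro x hx y hy hxy
  by_contra hne
  refine hskew x hx y hy hne (inc_of_pt_eq (t := x.cross l) ?_)
  rw [(hinc x hx).1.pt_cross (hinc x hx).2]
  simp only at hxy
  rw [hxy, (hinc y hy).1.pt_cross (hinc y hy).2]

/-- If a polynomial does not vanish on a line, few lines of a skew family meet that line at
a zero of the polynomial. -/
theorem card_le_of_res_ne_zero (l : NullLine K) {f : MvPolynomial (Fin 3) K} (hf : l.res f ≠ 0)
    {S : Finset (NullLine K)} (hinc : ∀ x ∈ S, x.Inc l ∧ x.slope ≠ l.slope)
    (hskew : ∀ x ∈ S, ∀ y ∈ S, x ≠ y → ¬ x.Inc y)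
    (hz : ∀ x ∈ S, eval (x.pt (x.cross l)) f = 0) : S.card ≤ f.totalDegree := by
  classical
  by_contra! hlt
  refine hf (l.res_eq_zero_of_roots (S.image fun x => x.cross l) ?_ ?_)
  · rwa [Finset.card_image_of_injOn (cross_injOn l hinc hskew)]
  · intro t ht
    obtain ⟨x, hx, rfl⟩ := Finset.mem_image.1 ht
    rw [← (hinc x hx).1.pt_cross (hinc x hx).2]
    exact hz x hx

end NullLine

section Bezout
variable {K : Type*} [Field K]

theorem finite_restrictTotalDegree (m : ℕ) :
    Module.Finite K (restrictTotalDegree (Fin 3) K m) := by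
  refine Module.finite_of_finrank_pos ?_
  have := finrank_restrictTotalDegree K m
  have : 0 < (m + 1) * (m + 2) * (m + 3) := by positivity
  omega

theorem finrank_add_card_le_of_separated {ι : Type*} [Fintype ι] {n : ℕ}
    {W : Submodule K (MvPolynomial (Fin 3) K)} (hW : W ≤ restrictTotalDegree (Fin 3) K n)
    (p : ι → Fin 3 → K) (hWp : ∀ w ∈ W, ∀ i, eval (p i) w = 0)
    (hsep : ∀ i, ∃ q : MvPolynomial (Fin 3) K, q.totalDegree ≤ n ∧ eval (p i) q ≠ 0 ∧
      ∀ j, j ≠ i → eval (p j) q = 0) :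
    Module.finrank K W + Fintype.card ι ≤ Module.finrank K (restrictTotalDegree (Fin 3) K n) := by
  classical
  have := finite_restrictTotalDegree (K := K) n
  let ev : restrictTotalDegree (Fin 3) K n →ₗ[K] (ι → K) :=
    LinearMap.pi fun i => (aeval (p i)).toLinearMap ∘ₗ (restrictTotalDegree (Fin 3) K n).subtype
  have hev : ∀ q i, ev q i = eval (p i) (q : MvPolynomial (Fin 3) K) := by
    intro q i
    simp [ev, aeval_eq_eval]
  have hsurj : Function.Surjective ev := by
    choose q hq1 hq2 hq3 using hsep
    intro v
    refine ⟨∑ i, (v i / eval (p i) (q i)) • ⟨q i, (mem_restrictTotalDegree _ _ _).2 (hq1 i)⟩, ?_⟩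
    funext j
    rw [map_sum, Finset.sum_apply, Finset.sum_eq_single j]
    · rw [map_smul, Pi.smul_apply, hev, smul_eq_mul, div_mul_cancel₀ _ (hq2 j)]
    · intro i _ hij
      rw [map_smul, Pi.smul_apply, hev, hq3 i j hij.symm, smul_zero]
    · simp
  have h1 := LinearMap.finrank_range_add_finrank_ker ev
  rw [LinearMap.range_eq_top.2 hsurj, finrank_top, Module.finrank_fintype_fun_eq_card] at h1
  have h2 : Module.finrank K W ≤ Module.finrank K (LinearMap.ker ev) := by
    refine LinearMap.finrank_le_finrank_of_injective
      (f := LinearMap.codRestrict _ (Submodule.inclusion hW) fun w => ?_) ?_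
    · rw [LinearMap.mem_ker]
      funext i
      rw [hev]
      exact hWp _ w.2 i
    · intro a b hab
      exact Submodule.inclusion_injective hW (congrArg Subtype.val hab)
  omega

/-- The degree-`n` part of the ideal generated by two polynomials without common factor. -/
theorem finrank_span_pair {f g : MvPolynomial (Fin 3) K} (hf : Irreducible f) (hfg : ¬ f ∣ g)
    {d e n : ℕ} (hd : f.totalDegree = d) (he : g.totalDegree = e) (hn : d + e ≤ n) :
    ∃ W : Submodule K (MvPolynomial (Fin 3) K), W ≤ restrictTotalDegree (Fin 3) K n ∧
      (∀ w ∈ W, ∃ a b, w = a * f + b * g) ∧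
      Module.finrank K (restrictTotalDegree (Fin 3) K (n - d)) +
        Module.finrank K (restrictTotalDegree (Fin 3) K (n - e)) ≤
      Module.finrank K W + Module.finrank K (restrictTotalDegree (Fin 3) K (n - d - e)) := by
  have hfin := finite_restrictTotalDegree (K := K)
  have hg0 : g ≠ 0 := by rintro rfl; exact hfg (dvd_zero _)
  let Φ : (restrictTotalDegree (Fin 3) K (n - d)) × (restrictTotalDegree (Fin 3) K (n - e)) →ₗ[K]
      MvPolynomial (Fin 3) K :=
    LinearMap.coprod
      (LinearMap.mulRight K f ∘ₗ (restrictTotalDegree (Fin 3) K (n - d)).subtype)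
      (LinearMap.mulRight K g ∘ₗ (restrictTotalDegree (Fin 3) K (n - e)).subtype)
  have hΦ : ∀ x, Φ x = (x.1 : MvPolynomial (Fin 3) K) * f + x.2 * g := fun x => by simp [Φ]
  refine ⟨LinearMap.range Φ, ?_, ?_, ?_⟩
  · rintro _ ⟨x, rfl⟩
    rw [hΦ, mem_restrictTotalDegree]
    have h1 := (mem_restrictTotalDegree _ _ _).1 x.1.2
    have h2 := (mem_restrictTotalDegree _ _ _).1 x.2.2
    refine (totalDegree_add _ _).trans (max_le ?_ ?_)
    · exact (totalDegree_mul _ _).trans (by omega)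
    · exact (totalDegree_mul _ _).trans (by omega)
  · rintro _ ⟨x, rfl⟩
    exact ⟨_, _, hΦ x⟩
  · have h1 := LinearMap.finrank_range_add_finrank_ker Φ
    rw [Module.finrank_prod] at h1
    have h2 : Module.finrank K (LinearMap.ker Φ) ≤
        Module.finrank K (restrictTotalDegree (Fin 3) K (n - d - e)) := by
      have hker : ∀ x ∈ LinearMap.ker Φ, ∃ c : restrictTotalDegree (Fin 3) K (n - d - e),
          (x.2 : MvPolynomial (Fin 3) K) = f * c := by
        intro x hx
        rw [LinearMap.mem_ker, hΦ] at hx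
        have hdvd : f ∣ (x.2 : MvPolynomial (Fin 3) K) * g :=
          ⟨-x.1, by linear_combination hx⟩
        obtain ⟨c, hc⟩ := (hf.prime.dvd_or_dvd hdvd).resolve_right hfg
        refine ⟨⟨c, ?_⟩, hc⟩
        rw [mem_restrictTotalDegree]
        by_cases hc0 : c = 0
        · simp [hc0]
        have h2 := (mem_restrictTotalDegree _ _ _).1 x.2.2
        rw [hc, totalDegree_mul_of_isDomain hf.ne_zero hc0] at h2
        omega
      choose! c hc using hker
      let Ψ : LinearMap.ker Φ →ₗ[K] restrictTotalDegree (Fin 3) K (n - d - e) :=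
        { toFun := fun x => c x
          map_add' := fun x y => by
            apply Subtype.ext
            apply mul_left_cancel₀ hf.ne_zero
            rw [← hc _ (x + y).2]
            simp only [Submodule.coe_add, Prod.snd_add, mul_add]
            rw [hc _ x.2, hc _ y.2]
          map_smul' := fun a x => by
            apply Subtype.ext
            apply mul_left_cancel₀ hf.ne_zero
            rw [← hc _ (a • x).2]
            simp only [Submodule.coe_smul, Prod.smul_snd, RingHom.id_apply]
            rw [hc _ x.2, mul_smul_comm] }
      refine LinearMap.finrank_le_finrank_of_injective (f := Ψ) ?_
      intro x y hxy
      have hx2 : (x.1.2 : MvPolynomial (Fin 3) K) = y.1.2 := by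
        rw [hc _ x.2, hc _ y.2, show c x.1 = c y.1 from hxy]
      have hx1 : (x.1.1 : MvPolynomial (Fin 3) K) = y.1.1 := by
        have h1 := x.2
        have h2 := y.2
        rw [LinearMap.mem_ker, hΦ] at h1 h2
        refine mul_right_cancel₀ hf.ne_zero ?_
        rw [hx2] at h1
        linear_combination h1 - h2
      exact Subtype.ext (Prod.ext (Subtype.ext hx1) (Subtype.ext hx2))
    omega

namespace NullLine

theorem exists_separating_params [Infinite K] (L : Finset (NullLine K)) (k : ℕ) :
    ∃ T : Finset K, T.card = k ∧ ∀ t ∈ T, ∀ l ∈ L, ∀ l' ∈ L, l ≠ l' → l.pt t ≠ l'.pt t := by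
  have hfin : (⋃ l ∈ L, ⋃ l' ∈ L, {t : K | l ≠ l' ∧ l.pt t = l'.pt t}).Finite := by
    refine L.finite_toSet.biUnion fun l _ => L.finite_toSet.biUnion fun l' _ => ?_
    refine Set.Subsingleton.finite ?_
    rintro t ⟨hne, ht⟩ t' ⟨-, ht'⟩
    by_contra h
    exact hne (eq_of_pt_eq h ht ht')
  obtain ⟨T, hT, hk⟩ := hfin.infinite_compl.exists_subset_card_eq k
  refine ⟨T, hk, fun t ht l hl l' hl' hne heq => hT ht ?_⟩
  simp only [Set.mem_iUnion]
  exact ⟨l, hl, l', hl', hne, heq⟩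

theorem eval_pt_eq_zero {l : NullLine K} {f : MvPolynomial (Fin 3) K} (h : l.res f = 0) (t : K) :
    eval (l.pt t) f = 0 := by
  rw [← eval_res, h, Polynomial.eval_zero]

/-- Two polynomials without common factor vanish simultaneously on few lines. -/
theorem card_le_totalDegree_mul [Infinite K] {f g : MvPolynomial (Fin 3) K} (hf : Irreducible f)
    (hfg : ¬ f ∣ g) {L : Finset (NullLine K)} (hLf : ∀ l ∈ L, l.res f = 0)
    (hLg : ∀ l ∈ L, l.res g = 0) : L.card ≤ f.totalDegree * g.totalDegree := by
  classical
  by_contra! hlt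
  obtain ⟨d, hd⟩ : ∃ d, f.totalDegree = d := ⟨_, rfl⟩
  obtain ⟨e, he⟩ : ∃ e, g.totalDegree = e := ⟨_, rfl⟩
  rw [hd, he] at hlt
  obtain ⟨L', hL', hN⟩ := Finset.exists_subset_card_eq hlt
  obtain ⟨m, hm⟩ : ∃ m, m = d * e * (d * e + 1) := ⟨_, rfl⟩
  obtain ⟨T, hT, hsep⟩ := exists_separating_params L' (m + d + e + 1 - d * e)
  obtain ⟨W, hW, hWmem, hWdim⟩ := finrank_span_pair (n := m + d + e) hf hfg hd he (by omega)
  have hde : d * e ≤ m := by rw [hm]; nlinarith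
  have key := finrank_add_card_le_of_separated hW
    (fun i : L' × T => (i.1 : NullLine K).pt i.2) ?_ ?_
  · simp only [Fintype.card_prod, Fintype.card_coe, hT, hN] at key
    have h1 := finrank_restrictTotalDegree K (m + d + e)
    have h2 := finrank_restrictTotalDegree K (m + d + e - d)
    have h3 := finrank_restrictTotalDegree K (m + d + e - e)
    have h4 := finrank_restrictTotalDegree K (m + d + e - d - e)
    rw [show m + d + e - d = m + e by omega] at *
    rw [show m + d + e - e = m + d by omega] at *
    rw [show m + e - e = m by omega] at *
    have h5 : d * e * 2 ≤ d * e * (d + e) := by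
      rcases Nat.eq_zero_or_pos (d * e) with h | h
      · simp [h]
      · have := Nat.pos_of_mul_pos_right h
        have := Nat.pos_of_mul_pos_left h
        exact Nat.mul_le_mul_left _ (by omega)
    generalize Module.finrank K (restrictTotalDegree (Fin 3) K (m + d + e)) = a1 at *
    generalize Module.finrank K (restrictTotalDegree (Fin 3) K (m + e)) = a2 at *
    generalize Module.finrank K (restrictTotalDegree (Fin 3) K (m + d)) = a3 at *
    generalize Module.finrank K (restrictTotalDegree (Fin 3) K m) = a4 at *
    generalize Module.finrank K W = a5 at *
    zify [show d * e ≤ m + d + e + 1 by omega] at *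
    nlinarith
  · rintro w hw ⟨⟨l, hl⟩, t⟩
    obtain ⟨a, b, rfl⟩ := hWmem w hw
    simp [eval_pt_eq_zero (hLf l (hL' hl)), eval_pt_eq_zero (hLg l (hL' hl))]
  · rintro ⟨⟨l, hl⟩, ⟨t, ht⟩⟩
    have hcoord : ∀ l' ∈ L'.erase l, ∃ i, l.pt t i ≠ l'.pt t i := by
      intro l' hl'
      rw [Finset.mem_erase] at hl'
      exact Function.ne_iff.1 (hsep t ht l hl l' hl'.2 hl'.1.symm)
    choose! i hi using hcoord
    refine ⟨(∏ t' ∈ T.erase t, (X 0 - C t')) * ∏ l' ∈ L'.erase l, (X (i l') - C (l'.pt t (i l'))),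
      ?_, ?_, ?_⟩
    · have hlin : ∀ (j : Fin 3) (a : K), (X j - C a : MvPolynomial (Fin 3) K).totalDegree ≤ 1 := by
        intro j a
        refine (totalDegree_sub _ _).trans ?_
        simp
      refine (totalDegree_mul _ _).trans ?_
      have h1 : (∏ t' ∈ T.erase t, (X 0 - C t') : MvPolynomial (Fin 3) K).totalDegree ≤
          (T.erase t).card := by
        refine (totalDegree_finsetProd _ _).trans ?_
        refine (Finset.sum_le_card_nsmul _ _ 1 fun _ _ => hlin _ _).trans (by simp)
      have h2 : (∏ l' ∈ L'.erase l, (X (i l') - C (l'.pt t (i l'))) :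
          MvPolynomial (Fin 3) K).totalDegree ≤ (L'.erase l).card := by
        refine (totalDegree_finsetProd _ _).trans ?_
        refine (Finset.sum_le_card_nsmul _ _ 1 fun _ _ => hlin _ _).trans (by simp)
      rw [Finset.card_erase_of_mem ht] at h1
      rw [Finset.card_erase_of_mem hl] at h2
      omega
    · rw [map_mul, map_prod, map_prod]
      refine mul_ne_zero (Finset.prod_ne_zero_iff.2 fun t' ht' => ?_)
        (Finset.prod_ne_zero_iff.2 fun l' hl' => ?_)
      · simpa [pt, sub_eq_zero] using (Finset.ne_of_mem_erase ht').symm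
      · simpa [sub_eq_zero] using hi l' hl'
    · rintro ⟨⟨l', hl'⟩, ⟨t', ht'⟩⟩ hne
      rw [map_mul, map_prod, map_prod]
      by_cases htt : t' = t
      · subst htt
        have hll : l' ≠ l := by rintro rfl; exact hne rfl
        rw [Finset.prod_eq_zero (Finset.mem_erase.2 ⟨hll, hl'⟩) (by simp), mul_zero]
      · rw [Finset.prod_eq_zero (Finset.mem_erase.2 ⟨htt, ht'⟩) (by simp [pt]), zero_mul]

end NullLine
end Bezout

section ODE
variable {K : Type*} [Field K]

theorem eq_zero_of_second_order_ode {D : ℕ} (hD : ∀ j : ℕ, 1 ≤ j → j ≤ D → (j : K) ≠ 0)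
    {φ a b c : Polynomial K} (hφ : φ.natDegree ≤ D)
    (hode : a * φ.derivative.derivative = b * φ.derivative + c * φ) {t : K} (ha : a.eval t ≠ 0)
    (h0 : φ.eval t = 0) (h1 : φ.derivative.eval t = 0) : φ = 0 := by
  by_contra hne
  obtain ⟨u, hu, hu0⟩ := Polynomial.exists_eq_pow_rootMultiplicity_mul_and_not_dvd φ hne t
  rw [Polynomial.dvd_iff_isRoot, Polynomial.IsRoot] at hu0
  have hn : φ.rootMultiplicity t ≤ φ.natDegree := by
    have h2 := congrArg Polynomial.natDegree hu
    have : u ≠ 0 := by rintro rfl; simp at hu0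
    rw [Polynomial.natDegree_mul (pow_ne_zero _ (Polynomial.X_sub_C_ne_zero t)) this,
      Polynomial.natDegree_pow, Polynomial.natDegree_X_sub_C] at h2
    omega
  generalize φ.rootMultiplicity t = n at hu hn
  rcases n with _ | _ | m
  · rw [hu] at h0
    simp at h0
    exact hu0 h0
  · rw [hu] at h1
    simp [Polynomial.derivative_mul] at h1
    exact hu0 h1
  · have hY : (Polynomial.X - Polynomial.C t : Polynomial K) ^ m ≠ 0 :=
      pow_ne_zero _ (Polynomial.X_sub_C_ne_zero t)
    rw [hu] at hode
    simp only [Polynomial.derivative_mul, Polynomial.derivative_X_sub_C_pow, map_add,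
      Nat.add_sub_cancel, map_natCast, Polynomial.derivative_natCast, zero_mul, zero_add] at hode
    set Y : Polynomial K := Polynomial.X - Polynomial.C t with hYdef
    have key : a * (((m + 1 + 1 : ℕ) : Polynomial K) * ((m + 1 : ℕ) : Polynomial K) * u) =
        Y * (b * (((m + 1 + 1 : ℕ) : Polynomial K) * u + Y * u.derivative) + c * Y * u -
          a * (2 * ((m + 1 + 1 : ℕ) : Polynomial K) * u.derivative +
            Y * u.derivative.derivative)) := by
      refine mul_left_cancel₀ hY ?_
      linear_combination hode
    have := congrArg (Polynomial.eval t) key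
    simp only [Polynomial.eval_mul, Polynomial.eval_natCast] at this
    rw [show Y.eval t = 0 by simp [hYdef], zero_mul] at this
    exact mul_ne_zero ha (mul_ne_zero (mul_ne_zero (hD _ (by omega) (by omega))
      (hD _ (by omega) (by omega))) hu0) this

end ODE

namespace NullLine
variable {K : Type*} [Field K]

/-- There is a polynomial of small degree vanishing on a given set of lines. -/
theorem exists_res_eq_zero (R : Finset (NullLine K)) {n : ℕ}
    (hn : 6 * R.card < (n + 2) * (n + 3)) :
    ∃ f : MvPolynomial (Fin 3) K, f ≠ 0 ∧ f.totalDegree ≤ n ∧ ∀ l ∈ R, l.res f = 0 := by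
  have := finite_restrictTotalDegree (K := K) n
  let Φ : restrictTotalDegree (Fin 3) K n →ₗ[K] (R × Fin (n + 1) → K) :=
    LinearMap.pi fun x => Polynomial.lcoeff K x.2 ∘ₗ (x.1 : NullLine K).res.toLinearMap ∘ₗ
      (restrictTotalDegree (Fin 3) K n).subtype
  have hlt : Module.finrank K (R × Fin (n + 1) → K) <
      Module.finrank K (restrictTotalDegree (Fin 3) K n) := by
    have h := finrank_restrictTotalDegree K n
    rw [Module.finrank_fintype_fun_eq_card, Fintype.card_prod, Fintype.card_coe, Fintype.card_fin]
    nlinarith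
  obtain ⟨x, hx, hx0⟩ :=
    (Submodule.ne_bot_iff _).1 (LinearMap.ker_ne_bot_of_finrank_lt hlt (f := Φ))
  have hdeg := (mem_restrictTotalDegree _ _ _).1 x.2
  refine ⟨x, fun h => hx0 (Subtype.ext h), hdeg, fun l hl => ?_⟩
  ext j
  rw [Polynomial.coeff_zero]
  rcases lt_or_ge n j with hj | hj
  · exact Polynomial.coeff_eq_zero_of_natDegree_lt
      (((l.natDegree_res_le _).trans hdeg).trans_lt hj)
  · exact congrFun (LinearMap.mem_ker.1 hx) (⟨l, hl⟩, ⟨j, Nat.lt_succ_of_le hj⟩)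

end NullLine

section Surface
variable {K : Type*} [Field K]

theorem totalDegree_pderiv_le {σ : Type*} (i : σ) (f : MvPolynomial σ K) :
    (pderiv i f).totalDegree ≤ f.totalDegree - 1 := by
  classical
  rw [totalDegree, Finset.sup_le_iff]
  intro m hm
  rw [mem_support_iff, coeff_pderiv] at hm
  have h1 : m + Finsupp.single i 1 ∈ f.support := mem_support_iff.2 (left_ne_zero_of_mul hm)
  have h2 := le_totalDegree h1
  rw [Finsupp.sum_add_index' (fun _ => rfl) (fun _ _ _ => rfl), Finsupp.sum_single_index rfl] at h2
  omega

theorem notMem_vars_of_pderiv_eq_zero {σ : Type*} {D : ℕ}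
    (hD : ∀ j : ℕ, 1 ≤ j → j ≤ D → (j : K) ≠ 0) {f : MvPolynomial σ K} (hf : f.totalDegree ≤ D)
    {i : σ} (h : pderiv i f = 0) : i ∉ f.vars := by
  classical
  rw [mem_vars_iff_mem_support]
  rintro ⟨m, hm, hi⟩
  rw [Finsupp.mem_support_iff] at hi
  have h1 := coeff_pderiv (i := i) f (m - Finsupp.single i 1)
  have hle : Finsupp.single i 1 ≤ m := by
    rw [Finsupp.single_le_iff]; omega
  have hmD : m i ≤ D := by
    refine le_trans ?_ ((le_totalDegree hm).trans hf)
    exact Finset.single_le_sum (f := fun i => m i) (fun _ _ => Nat.zero_le _)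
      (Finsupp.mem_support_iff.2 hi)
  rw [h, coeff_zero, tsub_add_cancel_of_le hle] at h1
  refine mul_ne_zero (mem_support_iff.1 hm) ?_ h1.symm
  have := hD (m i) (by omega) hmD
  rwa [Finsupp.tsub_apply, Finsupp.single_eq_same, ← Nat.cast_succ, Nat.succ_eq_add_one,
    Nat.sub_add_cancel (by omega)]

/-- The coefficients of `s` in the second derivative of `g` along a line of slope `s`. -/
noncomputable def second (g : MvPolynomial (Fin 3) K) : Fin 5 → MvPolynomial (Fin 3) K :=
  ![pderiv 0 (pderiv 0 g), pderiv 1 (pderiv 0 g) + pderiv 0 (pderiv 1 g),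
    pderiv 2 (pderiv 0 g) + pderiv 1 (pderiv 1 g) + pderiv 0 (pderiv 2 g),
    pderiv 2 (pderiv 1 g) + pderiv 1 (pderiv 2 g), pderiv 2 (pderiv 2 g)]

/-- Linear coefficient of the pseudo-quotient of the second derivative of `g` by the first one,
as polynomials in the slope (divided by `pderiv 2 g`). -/
noncomputable def quotLin (g : MvPolynomial (Fin 3) K) : MvPolynomial (Fin 3) K :=
  pderiv 2 g * second g 3 - second g 4 * pderiv 1 g

/-- Constant coefficient of the pseudo-quotient. -/
noncomputable def quotConst (g : MvPolynomial (Fin 3) K) : MvPolynomial (Fin 3) K :=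
  pderiv 2 g * (pderiv 2 g * second g 2 - second g 4 * pderiv 0 g) - quotLin g * pderiv 1 g

/-- Linear coefficient of the pseudo-remainder. -/
noncomputable def remLin (g : MvPolynomial (Fin 3) K) : MvPolynomial (Fin 3) K :=
  pderiv 2 g * (pderiv 2 g * pderiv 2 g * second g 1 - quotLin g * pderiv 0 g) -
    quotConst g * pderiv 1 g

/-- Constant coefficient of the pseudo-remainder. -/
noncomputable def remConst (g : MvPolynomial (Fin 3) K) : MvPolynomial (Fin 3) K :=
  pderiv 2 g * pderiv 2 g * pderiv 2 g * second g 0 - quotConst g * pderiv 0 g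

theorem totalDegree_rem_le (g : MvPolynomial (Fin 3) K) :
    (remLin g).totalDegree ≤ 4 * g.totalDegree ∧ (remConst g).totalDegree ≤ 4 * g.totalDegree := by
  set δ := g.totalDegree with hδ
  have hp : ∀ i, (pderiv i g).totalDegree ≤ δ :=
    fun i => (totalDegree_pderiv_le i g).trans (by omega)
  have hpp : ∀ i j, (pderiv i (pderiv j g)).totalDegree ≤ δ := fun i j =>
    (totalDegree_pderiv_le i _).trans ((Nat.sub_le _ _).trans (hp j))
  have hadd : ∀ {a b : MvPolynomial (Fin 3) K} {n : ℕ}, a.totalDegree ≤ n → b.totalDegree ≤ n →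
      (a + b).totalDegree ≤ n := fun ha hb => (totalDegree_add _ _).trans (max_le ha hb)
  have hsub : ∀ {a b : MvPolynomial (Fin 3) K} {n : ℕ}, a.totalDegree ≤ n → b.totalDegree ≤ n →
      (a - b).totalDegree ≤ n := fun ha hb => (totalDegree_sub _ _).trans (max_le ha hb)
  have hmul : ∀ {a b : MvPolynomial (Fin 3) K} {m n : ℕ} (k : ℕ), a.totalDegree ≤ m →
      b.totalDegree ≤ n → m + n = k → (a * b).totalDegree ≤ k :=
    fun k ha hb h => (totalDegree_mul _ _).trans (by omega)
  have hs : ∀ i, (second g i).totalDegree ≤ δ := by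
    intro i
    fin_cases i
    exacts [hpp _ _, hadd (hpp _ _) (hpp _ _), hadd (hadd (hpp _ _) (hpp _ _)) (hpp _ _),
      hadd (hpp _ _) (hpp _ _), hpp _ _]
  have hL : (quotLin g).totalDegree ≤ 2 * δ :=
    hsub (hmul _ (hp _) (hs _) (by ring)) (hmul _ (hs _) (hp _) (by ring))
  have hC : (quotConst g).totalDegree ≤ 3 * δ :=
    hsub (hmul _ (hp _) (hsub (hmul (2 * δ) (hp _) (hs _) (by ring))
      (hmul _ (hs _) (hp _) (by ring))) (by ring)) (hmul _ hL (hp _) (by ring))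
  exact ⟨hsub (hmul _ (hp _) (hsub (hmul (3 * δ) (hmul (2 * δ) (hp _) (hp _) (by ring)) (hs _)
      (by ring)) (hmul _ hL (hp _) (by ring))) (by ring)) (hmul _ hC (hp _) (by ring)),
    hsub (hmul _ (hmul (3 * δ) (hmul (2 * δ) (hp _) (hp _) (by ring)) (hp _) (by ring)) (hs _)
      (by ring)) (hmul _ hC (hp _) (by ring))⟩

end Surface

namespace NullLine
variable {K : Type*} [Field K]

theorem derivative_derivative_res (l : NullLine K) (g : MvPolynomial (Fin 3) K) :
    (l.res g).derivative.derivative =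
      l.res (second g 0) + Polynomial.C l.slope * l.res (second g 1) +
      Polynomial.C l.slope ^ 2 * l.res (second g 2) +
      Polynomial.C l.slope ^ 3 * l.res (second g 3) +
      Polynomial.C l.slope ^ 4 * l.res (second g 4) := by
  rw [derivative_res]
  simp only [Polynomial.derivative_add, Polynomial.derivative_C_mul, derivative_res]
  simp only [second, Matrix.cons_val, map_add, map_pow]
  ring

theorem derivative_res' (l : NullLine K) (g : MvPolynomial (Fin 3) K) :
    (l.res g).derivative = l.res (pderiv 0 g) + Polynomial.C l.slope * l.res (pderiv 1 g) +
      Polynomial.C l.slope ^ 2 * l.res (pderiv 2 g) := by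
  rw [derivative_res, map_pow]

theorem pseudo_division (l : NullLine K) (g : MvPolynomial (Fin 3) K) :
    l.res (pderiv 2 g) ^ 3 * (l.res g).derivative.derivative =
      (Polynomial.C l.slope ^ 2 * l.res (pderiv 2 g) ^ 2 * l.res (second g 4) +
        Polynomial.C l.slope * l.res (pderiv 2 g) * l.res (quotLin g) + l.res (quotConst g)) *
          (l.res g).derivative +
      (Polynomial.C l.slope * l.res (remLin g) + l.res (remConst g)) := by
  rw [derivative_derivative_res, derivative_res']
  simp only [remLin, remConst, quotConst, quotLin, map_sub, map_mul]
  ring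

/-- The first derivative vanishes along a line contained in the surface. -/
theorem eval_first_eq_zero {l : NullLine K} {g : MvPolynomial (Fin 3) K} (h : l.res g = 0) (t : K) :
    eval (l.pt t) (pderiv 0 g) + l.slope * eval (l.pt t) (pderiv 1 g) +
      l.slope ^ 2 * eval (l.pt t) (pderiv 2 g) = 0 := by
  have := congrArg (Polynomial.eval t) (l.derivative_res' g)
  rw [h] at this
  simpa [eval_res] using this.symm

theorem eval_rem_eq_zero {l : NullLine K} {g : MvPolynomial (Fin 3) K} (h : l.res g = 0) (t : K) :
    l.slope * eval (l.pt t) (remLin g) + eval (l.pt t) (remConst g) = 0 := by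
  have := congrArg (Polynomial.eval t) (l.pseudo_division g)
  rw [h] at this
  simpa [eval_res] using this.symm

theorem eval_rem_cross_eq_zero {r b : NullLine K} {g : MvPolynomial (Fin 3) K} (hr : r.res g = 0)
    (hb : b.res g = 0) (hinc : r.Inc b) (hs : r.slope ≠ b.slope) :
    eval (r.pt (r.cross b)) (remLin g) = 0 ∧ eval (r.pt (r.cross b)) (remConst g) = 0 := by
  have h1 := eval_rem_eq_zero hr (r.cross b)
  have h2 := eval_rem_eq_zero hb (r.cross b)
  rw [← hinc.pt_cross hs] at h2
  have h3 : eval (r.pt (r.cross b)) (remLin g) = 0 := by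
    have : (r.slope - b.slope) * eval (r.pt (r.cross b)) (remLin g) = 0 := by
      linear_combination h1 - h2
    exact (mul_eq_zero.1 this).resolve_left (sub_ne_zero.2 hs)
  exact ⟨h3, by simpa [h3] using h1⟩

/-- The line of given slope through a point. -/
def through (x : Fin 3 → K) (s : K) : NullLine K := ⟨s, x 1 - s * x 0, x 2 - s ^ 2 * x 0⟩

@[simp]
theorem through_slope (x : Fin 3 → K) (s : K) : (through x s).slope = s := rfl

@[simp]
theorem through_pt (x : Fin 3 → K) (s : K) : (through x s).pt (x 0) = x := by
  funext i
  fin_cases i <;> simp [through, pt]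

@[simp]
theorem through_pt_slope (l : NullLine K) (t : K) : through (l.pt t) l.slope = l := by
  ext <;> simp [through, pt]

theorem res_through_eq_zero {g : MvPolynomial (Fin 3) K} {D : ℕ}
    (hD : ∀ j : ℕ, 1 ≤ j → j ≤ D → (j : K) ≠ 0) (hg : g.totalDegree ≤ D)
    (h1 : g ∣ remLin g) (h0 : g ∣ remConst g) {x : Fin 3 → K} (hx : eval x g = 0)
    (hx2 : eval x (pderiv 2 g) ≠ 0) {s : K}
    (hs : eval x (pderiv 0 g) + s * eval x (pderiv 1 g) + s ^ 2 * eval x (pderiv 2 g) = 0) :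
    (through x s).res g = 0 := by
  obtain ⟨u, hu⟩ := h1
  obtain ⟨v, hv⟩ := h0
  have hdiv := (through x s).pseudo_division g
  rw [hu, hv, map_mul, map_mul] at hdiv
  have hode := hdiv.trans (b := _) (c := _ * ((through x s).res g).derivative +
    (Polynomial.C (through x s).slope * (through x s).res u + (through x s).res v) *
      (through x s).res g) (congrArg _ (by ring))
  refine eq_zero_of_second_order_ode (t := x 0) hD ((natDegree_res_le _ _).trans hg) hode ?_ ?_ ?_
  · simpa [eval_res] using hx2
  · simpa [eval_res] using hx
  · rw [derivative_res']
    simpa [eval_res] using hs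

theorem eval_cross_quadratic {r b : NullLine K} {g : MvPolynomial (Fin 3) K} (hr : r.res g = 0)
    (hb : b.res g = 0) (hinc : r.Inc b) (hs : r.slope ≠ b.slope) :
    eval (r.pt (r.cross b)) (pderiv 1 g) =
        -(r.slope + b.slope) * eval (r.pt (r.cross b)) (pderiv 2 g) ∧
      eval (r.pt (r.cross b)) (pderiv 0 g) =
        r.slope * b.slope * eval (r.pt (r.cross b)) (pderiv 2 g) := by
  have h1 := eval_first_eq_zero hr (r.cross b)
  have h2 := eval_first_eq_zero hb (r.cross b)
  rw [← hinc.pt_cross hs] at h2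
  have h3 : eval (r.pt (r.cross b)) (pderiv 1 g) +
      (r.slope + b.slope) * eval (r.pt (r.cross b)) (pderiv 2 g) = 0 := by
    have : (r.slope - b.slope) * (eval (r.pt (r.cross b)) (pderiv 1 g) +
        (r.slope + b.slope) * eval (r.pt (r.cross b)) (pderiv 2 g)) = 0 := by
      linear_combination h1 - h2
    exact (mul_eq_zero.1 this).resolve_left (sub_ne_zero.2 hs)
  exact ⟨by linear_combination h3, by linear_combination h1 - r.slope * h3⟩

/-- Constant part of the condition that the line of slope `σ` through a point meets `l`. -/
noncomputable def meetConst (l : NullLine K) : MvPolynomial (Fin 3) K :=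
  C (l.d - l.slope * l.c) - X 2 + C l.slope * X 1

/-- Linear part of the condition that the line of slope `σ` through a point meets `l`. -/
noncomputable def meetLin (l : NullLine K) : MvPolynomial (Fin 3) K :=
  X 1 - C l.c - C l.slope * X 0

theorem inc_through_iff (l : NullLine K) (x : Fin 3 → K) (s : K) :
    l.Inc (through x s) ↔ eval x l.meetConst + s * eval x l.meetLin = 0 := by
  simp only [Inc, through, meetConst, meetLin, map_add, map_sub, map_mul, eval_C, eval_X]
  constructor <;> intro h <;> linear_combination h

/-- Vanishes at points of the surface `g = 0` where one of the two tangent null directions gives a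
line meeting `l`. -/
noncomputable def meetPoly (l : NullLine K) (g : MvPolynomial (Fin 3) K) : MvPolynomial (Fin 3) K :=
  pderiv 0 g * l.meetLin ^ 2 - pderiv 1 g * l.meetConst * l.meetLin + pderiv 2 g * l.meetConst ^ 2

end NullLine

namespace NullLine
variable {K : Type*} [Field K]

/-- On a doubly ruled surface, the polynomial `meetPoly` of a generic line of the surface is
a multiple of the equation. -/
theorem dvd_meetPoly [Infinite K] {g : MvPolynomial (Fin 3) K} (hg : Irreducible g) {D : ℕ}
    (hD : ∀ j : ℕ, 1 ≤ j → j ≤ D → (j : K) ≠ 0) (hdeg : g.totalDegree ≤ D)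
    (h1 : g ∣ remLin g) (h0 : g ∣ remConst g) {r b : NullLine K} (hr : r.res g = 0)
    (hb : b.res g = 0) (hinc : r.Inc b) (hs : r.slope ≠ b.slope)
    (h2 : eval (r.pt (r.cross b)) (pderiv 2 g) ≠ 0) : g ∣ r.meetPoly g := by
  classical
  set w : MvPolynomial (Fin 3) K := pderiv 2 g * (pderiv 1 g + C (2 * r.slope) * pderiv 2 g) with hw
  have hwr : r.res w ≠ 0 := by
    intro h
    have := eval_pt_eq_zero h (r.cross b)
    rw [hw, map_mul, map_add, map_mul, eval_C, (eval_cross_quadratic hr hb hinc hs).1] at this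
    have h3 := (mul_eq_zero.1 this).resolve_left h2
    have h4 : (r.slope - b.slope) * eval (r.pt (r.cross b)) (pderiv 2 g) = 0 := by
      linear_combination h3
    exact mul_ne_zero (sub_ne_zero.2 hs) h2 h4
  let σ : K → K := fun t => -(eval (r.pt t) (pderiv 1 g) / eval (r.pt t) (pderiv 2 g)) - r.slope
  have hroot : ∀ t, t ∉ (r.res w).roots.toFinset → eval (r.pt t) (pderiv 2 g) ≠ 0 ∧
      σ t ≠ r.slope := by
    intro t ht
    rw [Multiset.mem_toFinset, Polynomial.mem_roots hwr, Polynomial.IsRoot, eval_res, hw,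
      map_mul, map_add, map_mul, eval_C] at ht
    obtain ⟨ht1, ht2⟩ := mul_ne_zero_iff.1 ht
    refine ⟨ht1, fun h => ht2 ?_⟩
    simp only [σ] at h
    have : eval (r.pt t) (pderiv 1 g) / eval (r.pt t) (pderiv 2 g) = -(2 * r.slope) := by
      linear_combination -h
    rw [div_eq_iff ht1] at this
    rw [this]; ring
  have hroot' : ∀ t, eval (r.pt t) (pderiv 2 g) ≠ 0 →
      eval (r.pt t) (pderiv 0 g) + σ t * eval (r.pt t) (pderiv 1 g) +
        σ t ^ 2 * eval (r.pt t) (pderiv 2 g) = 0 := by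
    intro t ht
    have h3 := eval_first_eq_zero hr t
    have h4 : (σ t + r.slope) * eval (r.pt t) (pderiv 2 g) = - eval (r.pt t) (pderiv 1 g) := by
      simp only [σ]; field_simp; ring
    linear_combination h3 + (σ t - r.slope) * h4
  let ℓ : K → NullLine K := fun t => through (r.pt t) (σ t)
  have hpt0 : ∀ t, (r.pt t) 0 = t := fun t => rfl
  have hℓpt : ∀ t, (ℓ t).pt t = r.pt t := fun t => through_pt (r.pt t) (σ t)
  by_contra hndvd
  obtain ⟨T, hT, hTcard⟩ :=
    ((r.res w).roots.toFinset.finite_toSet.infinite_compl).exists_subset_card_eq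
    (g.totalDegree * (r.meetPoly g).totalDegree + 1)
  have hT' : ∀ t ∈ T, t ∉ (r.res w).roots.toFinset := fun t ht => hT ht
  have hℓg : ∀ t ∈ T, (ℓ t).res g = 0 := fun t ht =>
    res_through_eq_zero hD hdeg h1 h0 (eval_pt_eq_zero hr t) (hroot t (hT' t ht)).1
      (hroot' t (hroot t (hT' t ht)).1)
  have hinj : Set.InjOn ℓ T := by
    intro t ht t' ht' heq
    by_contra hne
    have : ℓ t = r := by
      refine eq_of_pt_eq hne (hℓpt t) ?_
      rw [heq, hℓpt]
    exact (hroot t (hT' t ht)).2 (congrArg NullLine.slope this)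
  have hcard := card_le_totalDegree_mul hg hndvd (L := T.image ℓ) ?_ ?_
  · rw [Finset.card_image_of_injOn hinj, hTcard] at hcard
    omega
  · intro l hl
    obtain ⟨t, ht, rfl⟩ := Finset.mem_image.1 hl
    exact hℓg t ht
  · intro l hl
    obtain ⟨t, ht, rfl⟩ := Finset.mem_image.1 hl
    refine Polynomial.funext fun z => ?_
    rw [eval_res, Polynomial.eval_zero]
    have h3 := eval_first_eq_zero (hℓg t ht) z
    have h4 : r.Inc (ℓ t) := (inc_of_pt_eq (hℓpt t)).symm
    rw [← through_pt_slope (ℓ t) z, inc_through_iff] at h4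
    simp only [meetPoly, map_add, map_sub, map_mul, map_pow]
    generalize eval ((ℓ t).pt z) r.meetConst = A at *
    generalize eval ((ℓ t).pt z) r.meetLin = B at *
    obtain rfl : A = -((ℓ t).slope * B) := by linear_combination h4
    linear_combination B ^ 2 * h3

theorem inc_of_dvd_meetPoly {g : MvPolynomial (Fin 3) K} {l r b : NullLine K}
    (hl : g ∣ l.meetPoly g) (hr : r.res g = 0) (hb : b.res g = 0) (hinc : r.Inc b)
    (hs : r.slope ≠ b.slope) (h2 : eval (r.pt (r.cross b)) (pderiv 2 g) ≠ 0) :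
    l.Inc r ∨ l.Inc b := by
  obtain ⟨u, hu⟩ := hl
  have h3 : eval (r.pt (r.cross b)) (l.meetPoly g) = 0 := by
    rw [hu, map_mul, eval_pt_eq_zero hr, zero_mul]
  have hb' := l.inc_through_iff (b.pt (r.cross b)) b.slope
  have hr' := l.inc_through_iff (r.pt (r.cross b)) r.slope
  rw [through_pt_slope] at hb' hr'
  rw [← hinc.pt_cross hs] at hb'
  rw [hb', hr']
  obtain ⟨h4, h5⟩ := eval_cross_quadratic hr hb hinc hs
  simp only [meetPoly, map_add, map_sub, map_mul, map_pow, h4, h5] at h3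
  have h6 : eval (r.pt (r.cross b)) (pderiv 2 g) *
      ((eval (r.pt (r.cross b)) l.meetConst + r.slope * eval (r.pt (r.cross b)) l.meetLin) *
      (eval (r.pt (r.cross b)) l.meetConst + b.slope * eval (r.pt (r.cross b)) l.meetLin)) = 0 := by
    linear_combination h3
  exact mul_eq_zero.1 ((mul_eq_zero.1 h6).resolve_left h2)

end NullLine

namespace NullLine
variable {K : Type*} [Field K]

/-- A surface containing lines of two different slopes is not a cylinder. -/
theorem pderiv_two_ne_zero [Infinite K] {g : MvPolynomial (Fin 3) K} (hg : Irreducible g) {D : ℕ}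
    (hD : ∀ j : ℕ, 1 ≤ j → j ≤ D → (j : K) ≠ 0) (hdeg : g.totalDegree ≤ D) {r b : NullLine K}
    (hr : r.res g = 0) (hb : b.res g = 0) (hs : r.slope ≠ b.slope) : pderiv 2 g ≠ 0 := by
  classical
  intro h
  have hv := notMem_vars_of_pderiv_eq_zero hD hdeg h
  have hw : ∀ l : NullLine K, l.res (r.meetLin) =
      Polynomial.C (l.c - r.c) + Polynomial.C (l.slope - r.slope) * Polynomial.X := by
    intro l
    simp [res, meetLin]
    ring
  let tr : K → NullLine K := fun τ => ⟨r.slope, r.c, τ⟩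
  have htr : ∀ τ, (tr τ).res g = 0 := by
    intro τ
    rw [← hr]
    refine hom_congr_vars (f₁ := ((tr τ).res : MvPolynomial (Fin 3) K →+* Polynomial K))
      (f₂ := (r.res : MvPolynomial (Fin 3) K →+* Polynomial K)) ?_ ?_ rfl
    · ext; simp [res]
    · intro i hi _
      have : i ≠ 2 := by rintro rfl; exact hv hi
      fin_cases i
      · simp [res]
      · simp [res, tr]
      · simp at this
  have hdvd : g ∣ r.meetLin := by
    by_contra hndvd
    obtain ⟨T, hT⟩ := Infinite.exists_subset_card_eq K (g.totalDegree * r.meetLin.totalDegree + 1)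
    have := card_le_totalDegree_mul hg hndvd (L := T.image tr) ?_ ?_
    · rw [Finset.card_image_of_injective _ (fun a b hab => congrArg NullLine.d hab), hT] at this
      omega
    · intro l hl
      obtain ⟨t, -, rfl⟩ := Finset.mem_image.1 hl
      exact htr t
    · intro l hl
      obtain ⟨t, -, rfl⟩ := Finset.mem_image.1 hl
      simp [hw, tr]
  obtain ⟨u, hu⟩ := hdvd
  have := hw b
  rw [hu, map_mul, hb, zero_mul] at this
  have h1 := congrArg (fun p => Polynomial.coeff p 1) this
  simp only [Polynomial.coeff_zero, Polynomial.coeff_add, Polynomial.coeff_C_mul,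
    Polynomial.coeff_X_one, mul_one] at h1
  rw [Polynomial.coeff_C_of_ne_zero one_ne_zero, zero_add] at h1
  exact hs (sub_eq_zero.1 h1.symm).symm

open Classical in
/-- Incident pairs between two sets of lines. -/
noncomputable def incidences (R B : Finset (NullLine K)) : Finset (NullLine K × NullLine K) :=
  (R ×ˢ B).filter fun x => x.1.Inc x.2

theorem mem_incidences {R B : Finset (NullLine K)} {x : NullLine K × NullLine K} :
    x ∈ incidences R B ↔ x.1 ∈ R ∧ x.2 ∈ B ∧ x.1.Inc x.2 := by
  simp [incidences, and_assoc]

open Classical in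
/-- The lines of `S` incident to both `x` and `y`. -/
noncomputable def commonInc (S : Finset (NullLine K)) (x y : NullLine K) : Finset (NullLine K) :=
  S.filter fun l => l.Inc x ∧ l.Inc y

theorem mem_commonInc {S : Finset (NullLine K)} {x y l : NullLine K} :
    l ∈ commonInc S x y ↔ l ∈ S ∧ l.Inc x ∧ l.Inc y := by
  simp [commonInc]

theorem commonInc_mono {S S' : Finset (NullLine K)} (h : S' ⊆ S) (x y : NullLine K) :
    commonInc S' x y ⊆ commonInc S x y := fun l hl => by
  rw [mem_commonInc] at hl ⊢
  exact ⟨h hl.1, hl.2⟩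

/-- Two skew families of lines, transversal to each other, with few common neighbours. -/
structure Transversal (k : ℕ) (R B : Finset (NullLine K)) : Prop where
  slope_ne : ∀ r ∈ R, ∀ b ∈ B, r.slope ≠ b.slope
  skew_left : ∀ x ∈ R, ∀ y ∈ R, x ≠ y → ¬ x.Inc y
  skew_right : ∀ x ∈ B, ∀ y ∈ B, x ≠ y → ¬ x.Inc y
  card_left : ∀ x ∈ B, ∀ y ∈ B, x ≠ y → (commonInc R x y).card ≤ k
  card_right : ∀ x ∈ R, ∀ y ∈ R, x ≠ y → (commonInc B x y).card ≤ k

theorem Transversal.symm {k : ℕ} {R B : Finset (NullLine K)} (h : Transversal k R B) :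
    Transversal k B R :=
  ⟨fun b hb r hr => (h.slope_ne r hr b hb).symm, h.skew_right, h.skew_left, h.card_right,
    h.card_left⟩

theorem Transversal.mono {k : ℕ} {R B R' B' : Finset (NullLine K)} (h : Transversal k R B)
    (hR : R' ⊆ R) (hB : B' ⊆ B) : Transversal k R' B' :=
  ⟨fun r hr b hb => h.slope_ne r (hR hr) b (hB hb),
    fun x hx y hy => h.skew_left x (hR hx) y (hR hy),
    fun x hx y hy => h.skew_right x (hB hx) y (hB hy),
    fun x hx y hy hxy => (Finset.card_le_card (commonInc_mono hR x y)).trans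
      (h.card_left x (hB hx) y (hB hy) hxy),
    fun x hx y hy hxy => (Finset.card_le_card (commonInc_mono hB x y)).trans
      (h.card_right x (hR hx) y (hR hy) hxy)⟩

theorem card_incidences_comm (R B : Finset (NullLine K)) :
    (incidences B R).card = (incidences R B).card := by
  refine Finset.card_bij (fun x _ => x.swap) ?_ ?_ ?_
  · intro x hx
    rw [mem_incidences] at hx ⊢
    exact ⟨hx.2.1, hx.1, hx.2.2.symm⟩
  · intro x _ y _ h
    exact Prod.swap_injective h
  · intro x hx
    rw [mem_incidences] at hx
    exact ⟨x.swap, mem_incidences.2 ⟨hx.2.1, hx.1, hx.2.2.symm⟩, x.swap_swap⟩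

open Classical in
theorem card_incidences_smooth_le [Infinite K] {g : MvPolynomial (Fin 3) K} (hg : Irreducible g)
    {D : ℕ} (hD : ∀ j : ℕ, 1 ≤ j → j ≤ D → (j : K) ≠ 0) (hdeg : g.totalDegree ≤ D)
    (h1 : g ∣ remLin g) (h0 : g ∣ remConst g) {k : ℕ} {R B : Finset (NullLine K)}
    (hRB : Transversal k R B) (hR : ∀ r ∈ R, r.res g = 0) (hB : ∀ b ∈ B, b.res g = 0) :
    ((incidences R B).filter fun x => eval (x.1.pt (x.1.cross x.2)) (pderiv 2 g) ≠ 0).card ≤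
      k * B.card + R.card := by
  set G := (incidences R B).filter fun x => eval (x.1.pt (x.1.cross x.2)) (pderiv 2 g) ≠ 0 with hG
  have hmem : ∀ x ∈ G, x.1 ∈ R ∧ x.2 ∈ B ∧ x.1.Inc x.2 ∧
      eval (x.1.pt (x.1.cross x.2)) (pderiv 2 g) ≠ 0 := by
    intro x hx
    rw [hG, Finset.mem_filter, mem_incidences] at hx
    tauto
  have hall : ∀ x ∈ G, ∀ y ∈ G, x.1.Inc y.2 := by
    intro x hx y hy
    obtain ⟨hx1, hx2, hx3, hx4⟩ := hmem x hx
    obtain ⟨hy1, hy2, hy3, hy4⟩ := hmem y hy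
    have hd := dvd_meetPoly hg hD hdeg h1 h0 (hR _ hx1) (hB _ hx2) hx3
      (hRB.slope_ne _ hx1 _ hx2) hx4
    rcases inc_of_dvd_meetPoly hd (hR _ hy1) (hB _ hy2) hy3 (hRB.slope_ne _ hy1 _ hy2) hy4
      with h | h
    · by_cases hxy : x.1 = y.1
      · rw [hxy]; exact hy3
      · exact absurd h (hRB.skew_left _ hx1 _ hy1 hxy)
    · exact h
  rcases le_or_gt (G.image Prod.snd).card 1 with hc | hc
  · have hsub : G ⊆ R ×ˢ G.image Prod.snd := fun x hx =>
      Finset.mem_product.2 ⟨(hmem x hx).1, Finset.mem_image_of_mem _ hx⟩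
    have := Finset.card_le_card hsub
    rw [Finset.card_product] at this
    nlinarith
  · obtain ⟨b, hb, b', hb', hne⟩ := Finset.one_lt_card.1 hc
    obtain ⟨y, hy, rfl⟩ := Finset.mem_image.1 hb
    obtain ⟨y', hy', rfl⟩ := Finset.mem_image.1 hb'
    have hk : (G.image Prod.fst).card ≤ k := by
      refine (Finset.card_le_card ?_).trans
        (hRB.card_left _ (hmem y hy).2.1 _ (hmem y' hy').2.1 hne)
      intro r hr
      obtain ⟨x, hx, rfl⟩ := Finset.mem_image.1 hr
      exact mem_commonInc.2 ⟨(hmem x hx).1, hall x hx y hy, hall x hx y' hy'⟩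
    have hsub : G ⊆ G.image Prod.fst ×ˢ B := fun x hx =>
      Finset.mem_product.2 ⟨Finset.mem_image_of_mem _ hx, (hmem x hx).2.1⟩
    have := Finset.card_le_card hsub
    rw [Finset.card_product] at this
    nlinarith

open Classical in
theorem card_fiber_le {k : ℕ} {R B : Finset (NullLine K)} (hRB : Transversal k R B)
    {w : MvPolynomial (Fin 3) K} {r : NullLine K} (hr : r ∈ R) (hrw : r.res w ≠ 0) :
    (B.filter fun b => r.Inc b ∧ eval (r.pt (r.cross b)) w = 0).card ≤ w.totalDegree := by
  refine card_le_of_res_ne_zero r hrw ?_ ?_ ?_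
  · intro b hb
    rw [Finset.mem_filter] at hb
    exact ⟨hb.2.1.symm, (hRB.slope_ne _ hr _ hb.1).symm⟩
  · intro x hx y hy
    exact hRB.skew_right x (Finset.mem_filter.1 hx).1 y (Finset.mem_filter.1 hy).1
  · intro b hb
    rw [Finset.mem_filter] at hb
    rw [cross_comm, ← hb.2.1.pt_cross (hRB.slope_ne _ hr _ hb.1)]
    exact hb.2.2

open Classical in
theorem card_filter_fst_notMem_le {k e : ℕ} {R B : Finset (NullLine K)} (hRB : Transversal k R B)
    {w : MvPolynomial (Fin 3) K} (hw : w.totalDegree ≤ e) :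
    ((incidences R B).filter fun x => eval (x.1.pt (x.1.cross x.2)) w = 0 ∧ x.1.res w ≠ 0).card ≤
      e * R.card := by
  refine Finset.card_le_mul_card_image_of_maps_to (f := Prod.fst) (t := R) ?_ e ?_
  · intro x hx
    exact (mem_incidences.1 (Finset.mem_filter.1 hx).1).1
  · intro r hr
    by_cases hrw : r.res w = 0
    · rw [Finset.card_eq_zero.2]
      · exact Nat.zero_le _
      · refine Finset.filter_eq_empty_iff.2 fun x hx hxr => ?_
        rw [Finset.mem_filter, hxr] at hx
        exact hx.2.2 hrw
    · refine le_trans ?_ ((card_fiber_le hRB hr hrw).trans hw)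
      refine Finset.card_le_card_of_injOn Prod.snd ?_ ?_
      · intro x hx
        simp only [Finset.coe_filter, Finset.mem_filter, mem_incidences, Set.mem_ofPred_eq] at hx ⊢
        obtain ⟨⟨⟨_, h2, h3⟩, h4, _⟩, rfl⟩ := hx
        exact ⟨h2, h3, h4⟩
      · intro x hx y hy hxy
        simp only [Finset.coe_filter, Set.mem_ofPred_eq] at hx hy
        exact Prod.ext (hx.2.trans hy.2.symm) hxy

open Classical in
theorem card_incidences_zero_le [Infinite K] {g w : MvPolynomial (Fin 3) K} (hg : Irreducible g)
    (hgw : ¬ g ∣ w) {k e X : ℕ} (hw : w.totalDegree ≤ e) {R B : Finset (NullLine K)}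
    (hRB : Transversal k R B) (hR : ∀ r ∈ R, r.res g = 0) (hB : ∀ b ∈ B, b.res g = 0)
    (hX : ∀ R' ⊆ R, ∀ B' ⊆ B, R'.card ≤ g.totalDegree * e → B'.card ≤ g.totalDegree * e →
      (incidences R' B').card ≤ X * (R'.card + B'.card)) :
    ((incidences R B).filter fun x => eval (x.1.pt (x.1.cross x.2)) w = 0).card ≤
      e * (R.card + B.card) + X * (2 * (g.totalDegree * e)) := by
  have hzero : ∀ S : Finset (NullLine K), (∀ l ∈ S, l.res g = 0) →
      (S.filter fun l => l.res w = 0).card ≤ g.totalDegree * e := fun S hS =>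
    (card_le_totalDegree_mul hg hgw (fun l hl => hS l (Finset.mem_filter.1 hl).1)
      (fun l hl => (Finset.mem_filter.1 hl).2)).trans (Nat.mul_le_mul_left _ hw)
  obtain ⟨R', hR'⟩ : ∃ R', R' = R.filter fun l => l.res w = 0 := ⟨_, rfl⟩
  obtain ⟨B', hB'⟩ : ∃ B', B' = B.filter fun l => l.res w = 0 := ⟨_, rfl⟩
  have h4 : R'.card ≤ g.totalDegree * e := hR' ▸ hzero R hR
  have h5 : B'.card ≤ g.totalDegree * e := hB' ▸ hzero B hB
  have h3 := hX R' (hR' ▸ Finset.filter_subset _ _) B' (hB' ▸ Finset.filter_subset _ _) h4 h5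
  obtain ⟨Z, hZ⟩ : ∃ Z, Z = (incidences R B).filter fun x =>
    eval (x.1.pt (x.1.cross x.2)) w = 0 ∧ x.1.res w ≠ 0 := ⟨_, rfl⟩
  obtain ⟨Z', hZ'⟩ : ∃ Z', Z' = (incidences B R).filter fun x =>
    eval (x.1.pt (x.1.cross x.2)) w = 0 ∧ x.1.res w ≠ 0 := ⟨_, rfl⟩
  have h1 : Z.card ≤ e * R.card := hZ ▸ card_filter_fst_notMem_le hRB hw
  have h2 : Z'.card ≤ e * B.card := hZ' ▸ card_filter_fst_notMem_le hRB.symm hw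
  have hsub : ((incidences R B).filter fun x => eval (x.1.pt (x.1.cross x.2)) w = 0) ⊆
      (Z ∪ Z'.image Prod.swap) ∪ incidences R' B' := by
    rintro ⟨r, b⟩ hx
    obtain ⟨hx, hz⟩ := Finset.mem_filter.1 hx
    obtain ⟨hr, hb, hi⟩ := mem_incidences.1 hx
    by_cases hrw : r.res w = 0
    · by_cases hbw : b.res w = 0
      · refine Finset.mem_union_right _ (mem_incidences.2 ⟨?_, ?_, hi⟩)
        · rw [hR']; exact Finset.mem_filter.2 ⟨hr, hrw⟩
        · rw [hB']; exact Finset.mem_filter.2 ⟨hb, hbw⟩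
      · refine Finset.mem_union_left _ (Finset.mem_union_right _
          (Finset.mem_image.2 ⟨(b, r), ?_, rfl⟩))
        rw [hZ']
        refine Finset.mem_filter.2 ⟨mem_incidences.2 ⟨hb, hr, hi.symm⟩, ?_, hbw⟩
        rw [cross_comm, ← hi.pt_cross (hRB.slope_ne _ hr _ hb)]
        exact hz
    · refine Finset.mem_union_left _ (Finset.mem_union_left _ ?_)
      rw [hZ]
      exact Finset.mem_filter.2 ⟨hx, hz, hrw⟩
  have h6 := (Finset.card_le_card hsub).trans (Finset.card_union_le _ _)
  have h8 := Finset.card_union_le Z (Z'.image Prod.swap)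
  have h9 := Finset.card_image_le (s := Z') (f := Prod.swap)
  have h7 : X * (R'.card + B'.card) ≤ X * (2 * (g.totalDegree * e)) :=
    Nat.mul_le_mul_left _ (by omega)
  rw [Nat.mul_add e]
  omega

/-- Incidences between lines lying on an irreducible surface. -/
theorem card_incidences_surface_le [Infinite K] {g : MvPolynomial (Fin 3) K} (hg : Irreducible g)
    {D : ℕ} (hD : ∀ j : ℕ, 1 ≤ j → j ≤ D → (j : K) ≠ 0) (hdeg : g.totalDegree ≤ D)
    {k X : ℕ} {R B : Finset (NullLine K)}
    (hRB : Transversal k R B) (hR : ∀ r ∈ R, r.res g = 0) (hB : ∀ b ∈ B, b.res g = 0)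
    (hX : ∀ R' ⊆ R, ∀ B' ⊆ B, R'.card ≤ 4 * g.totalDegree ^ 2 → B'.card ≤ 4 * g.totalDegree ^ 2 →
      (incidences R' B').card ≤ X * (R'.card + B'.card)) :
    (incidences R B).card ≤ 4 * g.totalDegree * (R.card + B.card) + 8 * X * g.totalDegree ^ 2 +
      k * B.card + R.card := by
  classical
  have main : ∀ w : MvPolynomial (Fin 3) K, ¬ g ∣ w → w.totalDegree ≤ 4 * g.totalDegree →
      ((incidences R B).filter fun x => eval (x.1.pt (x.1.cross x.2)) w = 0).card ≤
        4 * g.totalDegree * (R.card + B.card) + 8 * X * g.totalDegree ^ 2 := by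
    intro w hgw hw
    refine (card_incidences_zero_le (X := X) hg hgw hw hRB hR hB ?_).trans (le_of_eq (by ring))
    intro R' hR' B' hB' h1 h2
    exact hX R' hR' B' hB' (h1.trans (le_of_eq (by ring))) (h2.trans (le_of_eq (by ring)))
  by_cases h1 : g ∣ remLin g
  · by_cases h0 : g ∣ remConst g
    · rcases Finset.eq_empty_or_nonempty (incidences R B) with he | ⟨x, hx⟩
      · simp [he]
      rw [mem_incidences] at hx
      have hne := pderiv_two_ne_zero hg hD hdeg (hR _ hx.1) (hB _ hx.2.1)
        (hRB.slope_ne _ hx.1 _ hx.2.1)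
      have hle := totalDegree_pderiv_le 2 g
      have hndvd : ¬ g ∣ pderiv 2 g := by
        intro hdvd
        have h2 := totalDegree_le_of_dvd_of_isDomain hdvd hne
        have h3 : g.totalDegree = 0 := by omega
        obtain ⟨c, rfl⟩ : ∃ c, g = C c := ⟨_, totalDegree_eq_zero_iff_eq_C.1 h3⟩
        simp at hne
      have h2 := main _ hndvd (by omega)
      have h3 := card_incidences_smooth_le hg hD hdeg h1 h0 hRB hR hB
      rw [← Finset.card_filter_add_card_filter_not
        (fun x : NullLine K × NullLine K => eval (x.1.pt (x.1.cross x.2)) (pderiv 2 g) = 0)]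
      simp only [ne_eq] at h3
      omega
    · refine le_trans (Finset.card_le_card ?_)
        ((main _ h0 (totalDegree_rem_le g).2).trans (by omega))
      intro x hx
      have hx' := mem_incidences.1 hx
      exact Finset.mem_filter.2 ⟨hx, (eval_rem_cross_eq_zero (hR _ hx'.1) (hB _ hx'.2.1) hx'.2.2
        (hRB.slope_ne _ hx'.1 _ hx'.2.1)).2⟩
  · refine le_trans (Finset.card_le_card ?_) ((main _ h1 (totalDegree_rem_le g).1).trans (by omega))
    intro x hx
    have hx' := mem_incidences.1 hx
    exact Finset.mem_filter.2 ⟨hx, (eval_rem_cross_eq_zero (hR _ hx'.1) (hB _ hx'.2.1) hx'.2.2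
      (hRB.slope_ne _ hx'.1 _ hx'.2.1)).1⟩

end NullLine

open Classical in
/-- If every `b ∈ B` has many neighbours in `R`, then a small part of `R` contains at least `d + 1`
neighbours of half of the elements of `B`. -/
theorem exists_small_saturating {α β : Type*} (r : α → β → Prop) (R : Finset α) {B : Finset β}
    (hB : B.Nonempty) {d X : ℕ} (hX₀ : 0 < X) (hX : 2 * d ≤ X)
    (hdeg : ∀ b ∈ B, X ≤ (R.filter fun a => r a b).card) :
    ∃ R₀ ⊆ R, R₀.card * X ≤ 4 * R.card * (d + 1) ∧
      B.card ≤ 2 * (B.filter fun b => d + 1 ≤ (R₀.filter fun a => r a b).card).card := by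
  let Φ : Finset α → ℕ := fun S => ∑ b ∈ B, min (d + 1) (S.filter fun a => r a b).card
  have hbd : ∀ S, Φ S ≤ B.card * (d + 1) := fun S =>
    (Finset.sum_le_card_nsmul _ _ (d + 1) fun b _ => min_le_left _ _).trans_eq (smul_eq_mul _ _)
  obtain ⟨S, hS, hmax⟩ := Finset.exists_max_image
    (R.powerset.filter fun S => S.card * B.card * X ≤ 4 * R.card * Φ S) Finset.card
    ⟨∅, by simp⟩
  simp only [Finset.mem_filter, Finset.mem_powerset] at hS hmax
  refine ⟨S, hS.1, ?_, ?_⟩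
  · have h1 := hS.2.trans (Nat.mul_le_mul_left (4 * R.card) (hbd S))
    refine Nat.le_of_mul_le_mul_left ?_ hB.card_pos
    nlinarith
  by_contra! hlt
  obtain ⟨U, hU⟩ : ∃ U, U = B.filter fun b => ¬ d + 1 ≤ (S.filter fun a => r a b).card := ⟨_, rfl⟩
  have hUcard : B.card ≤ 2 * U.card := by
    have := Finset.card_filter_add_card_filter_not (s := B)
      (fun b => d + 1 ≤ (S.filter fun a => r a b).card)
    rw [hU]
    omega
  have hgain : ∀ a ∈ R \ S, Φ (insert a S) = Φ S + (U.filter fun b => r a b).card := by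
    intro a ha
    have haS := (Finset.mem_sdiff.1 ha).2
    have : (U.filter fun b => r a b).card =
        ∑ b ∈ B, if ¬ d + 1 ≤ (S.filter fun a => r a b).card ∧ r a b then 1 else 0 := by
      rw [hU, Finset.filter_filter, Finset.card_filter]
    rw [this, ← Finset.sum_add_distrib]
    refine Finset.sum_congr rfl fun b _ => ?_
    rw [Finset.filter_insert]
    by_cases hab : r a b
    · rw [if_pos hab, Finset.card_insert_of_notMem (fun h => haS (Finset.mem_filter.1 h).1)]
      by_cases hd : d + 1 ≤ (S.filter fun a => r a b).card
      · simp only [hd, not_true_eq_false, false_and, if_false]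
        omega
      · simp only [hd, hab, not_false_eq_true, true_and, if_true]
        omega
    · simp [hab]
  have hcount : U.card * (X - d) ≤ ∑ a ∈ R \ S, (U.filter fun b => r a b).card := by
    have := Finset.sum_card_bipartiteAbove_eq_sum_card_bipartiteBelow (s := R \ S) (t := U) r
    simp only [Finset.bipartiteAbove, Finset.bipartiteBelow] at this
    rw [this, ← smul_eq_mul]
    refine Finset.card_nsmul_le_sum _ _ _ fun b hb => ?_
    rw [hU, Finset.mem_filter] at hb
    have h1 := hdeg b hb.1
    have h2 : R.filter (fun a => r a b) ⊆
        ((R \ S).filter fun a => r a b) ∪ S.filter fun a => r a b := by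
      intro a ha
      simp only [Finset.mem_union, Finset.mem_filter, Finset.mem_sdiff] at ha ⊢
      tauto
    have h3 := (Finset.card_le_card h2).trans (Finset.card_union_le _ _)
    omega
  obtain ⟨a, ha, hlarge⟩ : ∃ a ∈ R \ S,
      B.card * X ≤ 4 * R.card * (U.filter fun b => r a b).card := by
    by_contra! hcon
    have hXU : B.card * X ≤ 4 * (U.card * (X - d)) := by
      have : X ≤ 2 * (X - d) := by omega
      calc B.card * X ≤ (2 * U.card) * (2 * (X - d)) := Nat.mul_le_mul hUcard this
        _ = _ := by ring
    rcases (R \ S).eq_empty_or_nonempty with he | hne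
    · rw [he, Finset.sum_empty] at hcount
      have := Nat.mul_pos hB.card_pos hX₀
      omega
    · have h1 := Finset.sum_lt_sum_of_nonempty hne hcon
      rw [← Finset.mul_sum, Finset.sum_const, smul_eq_mul] at h1
      have h2 := Finset.card_le_card (Finset.sdiff_subset : R \ S ⊆ R)
      have h3 : 4 * R.card * (U.card * (X - d)) < R.card * (B.card * X) :=
        (Nat.mul_le_mul_left _ hcount).trans_lt (h1.trans_le (Nat.mul_le_mul_right _ h2))
      have h4 := Nat.mul_le_mul_left R.card hXU
      nlinarith
  have hins : (insert a S).card = S.card + 1 :=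
    Finset.card_insert_of_notMem (Finset.mem_sdiff.1 ha).2
  have := hmax (insert a S) ⟨Finset.insert_subset (Finset.mem_sdiff.1 ha).1 hS.1, ?_⟩
  · omega
  · rw [hgain a ha, hins]
    nlinarith [hS.2]

namespace NullLine
variable {K : Type*} [Field K]

open Classical in
theorem card_incidences_eq_sum (R B : Finset (NullLine K)) :
    (incidences R B).card = ∑ b ∈ B, (R.filter fun r => r.Inc b).card := by
  rw [incidences, Finset.card_filter, Finset.sum_product_right]
  exact Finset.sum_congr rfl fun b _ => (Finset.card_filter _ _).symm

open Classical in
/-- Lines lying on an irreducible surface, against arbitrary lines. -/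
theorem card_incidences_on_surface_le [Infinite K] {g : MvPolynomial (Fin 3) K} (hg : Irreducible g)
    {D : ℕ} (hD : ∀ j : ℕ, 1 ≤ j → j ≤ D → (j : K) ≠ 0) (hdeg : g.totalDegree ≤ D)
    {k X : ℕ} {R B : Finset (NullLine K)}
    (hRB : Transversal k R B) (hB : ∀ b ∈ B, b.res g = 0)
    (hX : ∀ R' ⊆ R, ∀ B' ⊆ B, R'.card ≤ 4 * g.totalDegree ^ 2 → B'.card ≤ 4 * g.totalDegree ^ 2 →
      (incidences R' B').card ≤ X * (R'.card + B'.card)) :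
    (incidences R B).card ≤ 5 * g.totalDegree * R.card + R.card +
      (4 * g.totalDegree + k) * B.card + 8 * X * g.totalDegree ^ 2 := by
  obtain ⟨R', hR'⟩ : ∃ R', R' = R.filter fun r => r.res g = 0 := ⟨_, rfl⟩
  have hsub : R' ⊆ R := hR' ▸ Finset.filter_subset _ _
  have h1 := card_incidences_surface_le hg hD hdeg (hRB.mono hsub subset_rfl)
    (fun r hr => by rw [hR'] at hr; exact (Finset.mem_filter.1 hr).2) hB
    (fun S hS => hX S (hS.trans hsub))
  have h2 := card_filter_fst_notMem_le hRB (le_refl g.totalDegree)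
  have h3 : incidences R B ⊆ incidences R' B ∪
      (incidences R B).filter fun x => eval (x.1.pt (x.1.cross x.2)) g = 0 ∧ x.1.res g ≠ 0 := by
    intro x hx
    obtain ⟨h4, h5, h6⟩ := mem_incidences.1 hx
    by_cases h7 : x.1.res g = 0
    · exact Finset.mem_union_left _ (mem_incidences.2 ⟨hR' ▸ Finset.mem_filter.2 ⟨h4, h7⟩, h5, h6⟩)
    · refine Finset.mem_union_right _ (Finset.mem_filter.2 ⟨hx, ?_, h7⟩)
      rw [h6.pt_cross (hRB.slope_ne _ h4 _ h5)]
      exact eval_pt_eq_zero (hB _ h5) _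
  have h4 := (Finset.card_le_card h3).trans (Finset.card_union_le _ _)
  have h5 := Finset.card_le_card hsub
  have h6 := Nat.mul_le_mul_left (4 * g.totalDegree) h5
  nlinarith

open Classical in
/-- Incidences between lines lying on a surface and arbitrary lines. -/
theorem card_incidences_on_reducible_surface_le [Infinite K] {f : MvPolynomial (Fin 3) K}
    (hf : f ≠ 0) {D : ℕ} (hD : ∀ j : ℕ, 1 ≤ j → j ≤ D → (j : K) ≠ 0) (hdeg : f.totalDegree ≤ D)
    {k X : ℕ} {R B : Finset (NullLine K)}
    (hRB : Transversal k R B) (hB : ∀ b ∈ B, b.res f = 0)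
    (hX : ∀ R' ⊆ R, ∀ B' ⊆ B, R'.card ≤ 4 * f.totalDegree ^ 2 → B'.card ≤ 4 * f.totalDegree ^ 2 →
      (incidences R' B').card ≤ X * (R'.card + B'.card)) :
    (incidences R B).card ≤ 6 * f.totalDegree * R.card +
      (4 * f.totalDegree + k) * B.card + 8 * X * f.totalDegree ^ 2 := by
  induction f using UniqueFactorizationMonoid.induction_on_prime generalizing B with
  | h₁ => exact absurd rfl hf
  | h₂ u hu =>
    rcases B.eq_empty_or_nonempty with rfl | ⟨b, hb⟩
    · simp [incidences]
    · have := hu.map b.res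
      rw [hB b hb] at this
      exact absurd this not_isUnit_zero
  | h₃ f g hf0 hg ih =>
    have hdg := totalDegree_mul_of_isDomain hg.ne_zero hf0
    have hg1 : 1 ≤ g.totalDegree := by
      by_contra! h
      obtain ⟨c, rfl⟩ : ∃ c, g = C c := ⟨_, totalDegree_eq_zero_iff_eq_C.1 (by omega)⟩
      refine hg.not_isUnit (IsUnit.map C (isUnit_iff_ne_zero.2 ?_))
      rintro rfl
      exact hg.ne_zero C_0
    have hsq : g.totalDegree ^ 2 + f.totalDegree ^ 2 ≤ (g * f).totalDegree ^ 2 := by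
      rw [hdg]; nlinarith
    obtain ⟨B₁, hB₁⟩ : ∃ B₁, B₁ = B.filter fun b => b.res g = 0 := ⟨_, rfl⟩
    obtain ⟨B₂, hB₂⟩ : ∃ B₂, B₂ = B.filter fun b => ¬ b.res g = 0 := ⟨_, rfl⟩
    have hs₁ : B₁ ⊆ B := hB₁ ▸ Finset.filter_subset _ _
    have hs₂ : B₂ ⊆ B := hB₂ ▸ Finset.filter_subset _ _
    have h1 := card_incidences_on_surface_le (X := X) hg.irreducible hD (by omega)
      (hRB.mono subset_rfl hs₁) (fun b hb => by rw [hB₁] at hb; exact (Finset.mem_filter.1 hb).2)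
      (fun R' hR' B' hB' h h' => hX R' hR' B' (hB'.trans hs₁) (by omega) (by omega))
    have h2 := ih (B := B₂) hf0 (by omega) (hRB.mono subset_rfl hs₂)
      (fun b hb => by
        obtain ⟨hb, hbg⟩ := Finset.mem_filter.1 (hB₂ ▸ hb)
        have := hB b hb
        rw [map_mul] at this
        exact (mul_eq_zero.1 this).resolve_left hbg)
      (fun R' hR' B' hB' h h' => hX R' hR' B' (hB'.trans hs₂) (by omega) (by omega))
    have h3 : (incidences R B).card = (incidences R B₁).card + (incidences R B₂).card := by
      simp only [card_incidences_eq_sum]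
      rw [hB₁, hB₂, Finset.sum_filter_add_sum_filter_not]
    have h4 : B.card = B₁.card + B₂.card := by
      rw [hB₁, hB₂, Finset.card_filter_add_card_filter_not]
    have h5 := Nat.mul_le_mul_left (8 * X) hsq
    have h6 := Nat.mul_le_mul_right R.card hg1
    rw [h3, h4]
    rw [hdg] at h5 ⊢
    nlinarith [Nat.zero_le (g.totalDegree * B₂.card), Nat.zero_le (f.totalDegree * B₁.card)]

open Classical in
theorem card_incidences_le_of_degree [Infinite K] {k X : ℕ} {R B : Finset (NullLine K)}
    (hX : 200 ≤ X) (hXk : 8 * k ≤ X) (hXn : 92160 * R.card ≤ X ^ 2)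
    (hD : ∀ j : ℕ, 1 ≤ j → j ≤ 24 * R.card / X + 1 → (j : K) ≠ 0)
    (hRB : Transversal k R B) (hcard : R.card ≤ B.card) (hB : B.Nonempty)
    (hdeg : ∀ b ∈ B, X < (R.filter fun r => r.Inc b).card) :
    ∃ R' ⊆ R, ∃ B' ⊆ B, R'.card + B'.card < R.card + B.card ∧
      X * (R'.card + B'.card) < (incidences R' B').card := by
  by_contra! hcon
  obtain ⟨d, hd⟩ : ∃ d, d = 24 * R.card / X + 1 := ⟨_, rfl⟩
  rw [← hd] at hD
  have hXpos : 0 < X := by omega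
  have hd1 : 24 * R.card < d * X := by
    rw [hd, mul_comm _ X]; exact Nat.lt_mul_div_succ _ hXpos
  have hd2 : (d - 1) * X ≤ 24 * R.card := by
    rw [hd, Nat.add_sub_cancel]; exact Nat.div_mul_le_self _ _
  obtain ⟨e, rfl⟩ : ∃ e, d = e + 1 := ⟨_, hd⟩
  clear hd
  simp only [Nat.add_sub_cancel] at hd2
  have hRX : X ≤ R.card := by
    obtain ⟨b, hb⟩ := hB
    exact (hdeg b hb).le.trans (Finset.card_filter_le _ _)
  have he : 3840 * e ≤ X := by
    refine Nat.le_of_mul_le_mul_right ?_ hXpos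
    nlinarith
  have hdX : (e + 1) * 80 ≤ X := by omega
  have hdm : 64 * (e + 1) ^ 2 ≤ R.card := by
    have h1 : (e + 1) * X ≤ 25 * R.card := by linarith
    have h2 := Nat.pow_le_pow_left h1 2
    have h3 := Nat.mul_le_mul_right ((e + 1) ^ 2) hXn
    refine Nat.le_of_mul_le_mul_right (c := R.card) ?_ (by omega)
    nlinarith
  obtain ⟨R₀, hR₀, hR₀card, hsat⟩ := exists_small_saturating (fun r b : NullLine K => r.Inc b) R hB
    (d := e + 1) hXpos (by omega) (fun b hb => (hdeg b hb).le)
  obtain ⟨f, hf, hfdeg, hfR⟩ := exists_res_eq_zero R₀ (n := e + 1) (by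
    refine Nat.lt_of_mul_lt_mul_right (a := X) ?_
    nlinarith)
  obtain ⟨B₁, hB₁⟩ : ∃ B₁, B₁ = B.filter fun b => e + 1 + 1 ≤ (R₀.filter fun a => a.Inc b).card :=
    ⟨_, rfl⟩
  have hs : B₁ ⊆ B := hB₁ ▸ Finset.filter_subset _ _
  rw [← hB₁] at hsat
  have hB₁f : ∀ b ∈ B₁, b.res f = 0 := by
    intro b hb
    obtain ⟨hb, hbd⟩ := Finset.mem_filter.1 (hB₁ ▸ hb)
    by_contra hne
    have := card_le_of_res_ne_zero b hne (S := R₀.filter fun a => a.Inc b)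
      (fun x hx => ⟨(Finset.mem_filter.1 hx).2,
        hRB.slope_ne _ (hR₀ (Finset.mem_filter.1 hx).1) _ hb⟩)
      (fun x hx y hy => hRB.skew_left _ (hR₀ (Finset.mem_filter.1 hx).1) _
        (hR₀ (Finset.mem_filter.1 hy).1))
      (fun x hx => eval_pt_eq_zero (hfR _ (Finset.mem_filter.1 hx).1) _)
    omega
  have hfsq : f.totalDegree ^ 2 ≤ (e + 1) ^ 2 := Nat.pow_le_pow_left hfdeg 2
  have hmain := card_incidences_on_reducible_surface_le (X := X) hf hD hfdeg
    (hRB.mono subset_rfl hs) hB₁f (fun R' hR' B' hB' h h' => hcon R' hR' B' (hB'.trans hs) (by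
      have : 0 < (e + 1) ^ 2 := by positivity
      omega))
  have hlow : B₁.card * X ≤ (incidences R B₁).card := by
    rw [card_incidences_eq_sum, ← smul_eq_mul]
    exact Finset.card_nsmul_le_sum _ _ _ fun b hb => (hdeg b (hs hb)).le
  have hBpos := hB.card_pos
  have hBs := Finset.card_le_card hs
  have h1 : 6 * f.totalDegree * R.card ≤ 6 * (e + 1) * B.card := by gcongr
  have h2 : (4 * f.totalDegree + k) * B₁.card ≤ (4 * (e + 1) + k) * B.card := by gcongr
  have h3 : 8 * X * f.totalDegree ^ 2 ≤ 8 * X * (e + 1) ^ 2 := by gcongr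
  have h4 : 64 * (X * (e + 1) ^ 2) ≤ X * B.card := by
    have := Nat.mul_le_mul_left X (hdm.trans hcard)
    linarith
  have h5 : 8 * (10 * (e + 1) + k) * B.card ≤ 2 * X * B.card := by
    exact Nat.mul_le_mul_right _ (by omega)
  have h6 : B.card * X ≤ 2 * (B₁.card * X) := by
    have := Nat.mul_le_mul_right X hsat
    linarith
  have h7 : 0 < X * B.card := by positivity
  nlinarith

/-- Incidences between two transversal families of lines with few common neighbours. -/
theorem card_incidences_le [Infinite K] {k X n : ℕ}
    (hX : 200 ≤ X) (hXk : 8 * k ≤ X) (hXn : 92160 * n ≤ X ^ 2)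
    (hD : ∀ j : ℕ, 1 ≤ j → j ≤ 24 * n / X + 1 → (j : K) ≠ 0) {R B : Finset (NullLine K)}
    (hRB : Transversal k R B) (hn : R.card + B.card ≤ n) :
    (incidences R B).card ≤ X * (R.card + B.card) := by
  classical
  induction hs : R.card + B.card using Nat.strong_induction_on generalizing R B with
  | _ s ih =>
  subst hs
  wlog hcard : R.card ≤ B.card generalizing R B
  · rw [← card_incidences_comm, add_comm R.card]
    refine this hRB.symm (by omega) (fun m hm R' B' h1 h2 h3 => ?_) (by omega)
    exact ih m (by omega) h1 h2 h3
  rcases B.eq_empty_or_nonempty with rfl | hB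
  · simp [incidences]
  by_cases hdeg : ∀ b ∈ B, X < (R.filter fun r => r.Inc b).card
  · obtain ⟨R', hR', B', hB', h1, h2⟩ := card_incidences_le_of_degree hX hXk
      (le_trans (by omega) hXn) (fun j h1 h2 => hD j h1 (h2.trans (by gcongr; omega)))
      hRB hcard hB hdeg
    exact absurd (ih _ h1 (hRB.mono hR' hB') (by omega) rfl) (by omega)
  · push Not at hdeg
    obtain ⟨b, hb, hbX⟩ := hdeg
    have h0 := Finset.card_erase_add_one hb
    have h1 := ih _ (by omega) (hRB.mono subset_rfl (Finset.erase_subset b B)) (by omega) rfl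
    have h2 : (incidences R B).card =
        (incidences R (B.erase b)).card + (R.filter fun r => r.Inc b).card := by
      simp only [card_incidences_eq_sum]
      rw [Finset.sum_erase_add _ _ hb]
    rw [h2, ← h0]
    nlinarith

end NullLine

end LinesInSpace

/-- The null polarity of three-space given by an alternating form. -/
def Conj {K : Type*} [CommRing K] (p q : K × K × K) : Prop :=
  p.2.1 - q.2.1 + p.1 * q.2.2 - q.1 * p.2.2 = 0

namespace NullLine
variable {K : Type*} [Field K]

/-- The first family of lines attached to the points of three-space. -/
def red (a b : K) (p : K × K × K) : NullLine K :=
  ⟨p.1, p.2.2, p.2.1 + a * p.1 + b * p.2.2 + p.1 * p.2.2⟩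

/-- The second family of lines attached to the points of three-space. -/
def blue (a b : K) (q : K × K × K) : NullLine K :=
  ⟨q.1 + b, q.2.2 - a, q.2.1 + (q.1 + b) * (q.2.2 - a)⟩

theorem inc_red_blue (a b : K) (p q : K × K × K) : (red a b p).Inc (blue a b q) ↔ Conj p q := by
  unfold Inc Conj red blue
  rw [← sub_eq_zero]
  ring_nf

theorem red_injective (a b : K) : Function.Injective (red a b) := by
  rintro ⟨U, V, W⟩ ⟨U', V', W'⟩ h
  simp only [red, NullLine.mk.injEq] at h
  obtain ⟨rfl, rfl, h⟩ := h
  simpa using h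

theorem blue_injective (a b : K) : Function.Injective (blue a b) := by
  rintro ⟨U, V, W⟩ ⟨U', V', W'⟩ h
  simp only [blue, NullLine.mk.injEq, add_left_inj, sub_left_inj] at h
  obtain ⟨rfl, rfl, h⟩ := h
  simpa using h

/-- For generic parameters, both families are skew and transversal to each other. -/
theorem exists_generic [Infinite K] (P : Finset (K × K × K)) : ∃ a b : K,
    (∀ p ∈ P, ∀ q ∈ P, (red a b p).slope ≠ (blue a b q).slope) ∧
    (∀ p ∈ P, ∀ q ∈ P, p ≠ q → ¬ (red a b p).Inc (red a b q)) ∧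
    ∀ p ∈ P, ∀ q ∈ P, p ≠ q → ¬ (blue a b p).Inc (blue a b q) := by
  classical
  let f₁ : (K × K × K) × (K × K × K) → K := fun x => x.1.1 - x.2.1
  let f₂ : (K × K × K) × (K × K × K) → K := fun x =>
    x.1.1 - (x.1.2.1 - x.2.2.1) / (x.1.2.2 - x.2.2.2)
  let f₃ : (K × K × K) × (K × K × K) → K := fun x =>
    (x.1.2.1 - x.2.2.1) / (x.1.2.2 - x.2.2.2) - x.1.1
  obtain ⟨b, hb⟩ := Infinite.exists_notMem_finset
    (((P ×ˢ P).image f₁ ∪ (P ×ˢ P).image f₂) ∪ (P ×ˢ P).image f₃)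
  let g₁ : (K × K × K) × (K × K × K) → K := fun x =>
    -(x.1.2.1 - x.2.2.1 + b * (x.1.2.2 - x.2.2.2) + (x.1.1 * x.2.2.2 - x.2.1 * x.1.2.2)) /
      (x.1.1 - x.2.1)
  let g₂ : (K × K × K) × (K × K × K) → K := fun x =>
    (x.1.2.1 - x.2.2.1 + (x.1.1 * x.2.2.2 - x.2.1 * x.1.2.2) + b * (x.2.2.2 - x.1.2.2)) /
      (x.1.1 - x.2.1)
  obtain ⟨a, ha⟩ := Infinite.exists_notMem_finset ((P ×ˢ P).image g₁ ∪ (P ×ˢ P).image g₂)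
  have hb' : ∀ p ∈ P, ∀ q ∈ P, b ≠ f₁ (p, q) ∧ b ≠ f₂ (p, q) ∧ b ≠ f₃ (p, q) := by
    intro p hp q hq
    have hm : (p, q) ∈ P ×ˢ P := Finset.mem_product.2 ⟨hp, hq⟩
    refine ⟨?_, ?_, ?_⟩ <;> rintro h <;> refine hb ?_ <;>
      simp only [Finset.mem_union, h, Finset.mem_image_of_mem _ hm, true_or, or_true]
  have ha' : ∀ p ∈ P, ∀ q ∈ P, a ≠ g₁ (p, q) ∧ a ≠ g₂ (p, q) := by
    intro p hp q hq
    have hm : (p, q) ∈ P ×ˢ P := Finset.mem_product.2 ⟨hp, hq⟩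
    refine ⟨?_, ?_⟩ <;> rintro h <;> refine ha ?_ <;>
      simp only [Finset.mem_union, h, Finset.mem_image_of_mem _ hm, true_or, or_true]
  refine ⟨a, b, ?_, ?_, ?_⟩
  · intro p hp q hq h
    refine (hb' p hp q hq).1 ?_
    simp only [red, blue] at h
    simp only [f₁]
    linear_combination -h
  · rintro ⟨U, V, W⟩ hp ⟨U', V', W'⟩ hq hne h
    obtain ⟨-, h2, -⟩ := hb' _ hp _ hq
    obtain ⟨h3, -⟩ := ha' _ hp _ hq
    simp only [red, Inc, f₂, g₁] at h h2 h3
    by_cases hU : U = U'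
    · subst hU
      by_cases hW : W = W'
      · subst hW
        refine hne ?_
        have : V = V' := by linear_combination h
        rw [this]
      · refine h2 ?_
        have : W - W' ≠ 0 := sub_ne_zero.2 hW
        field_simp
        linear_combination h
    · refine h3 ?_
      rw [eq_div_iff (sub_ne_zero.2 hU)]
      linear_combination h
  · rintro ⟨U, V, W⟩ hp ⟨U', V', W'⟩ hq hne h
    obtain ⟨-, -, h2⟩ := hb' _ hp _ hq
    obtain ⟨-, h3⟩ := ha' _ hp _ hq
    simp only [blue, Inc, f₃, g₂] at h h2 h3
    by_cases hU : U = U'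
    · subst hU
      by_cases hW : W = W'
      · subst hW
        refine hne ?_
        have : V = V' := by linear_combination h
        rw [this]
      · refine h2 ?_
        have : W - W' ≠ 0 := sub_ne_zero.2 hW
        field_simp
        linear_combination -h
    · refine h3 ?_
      rw [eq_div_iff (sub_ne_zero.2 hU)]
      linear_combination -h

end NullLine

open NullLine

theorem Conj.symm {K : Type*} [CommRing K] {p q : K × K × K} (h : Conj p q) : Conj q p := by
  unfold Conj at *
  linear_combination -h

open Classical in
/-- Conjugate pairs in a finite point set without large complete bipartite configurations. -/
theorem card_conj_le {K : Type*} [Field K] [Infinite K] {k X : ℕ} {P : Finset (K × K × K)}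
    (hX : 200 ≤ X) (hXk : 8 * k ≤ X) (hXn : 92160 * (2 * P.card) ≤ X ^ 2)
    (hD : ∀ j : ℕ, 1 ≤ j → j ≤ 24 * (2 * P.card) / X + 1 → (j : K) ≠ 0)
    (hk : ∀ x ∈ P, ∀ y ∈ P, x ≠ y → (P.filter fun z => Conj z x ∧ Conj z y).card ≤ k) :
    ((P ×ˢ P).filter fun x => Conj x.1 x.2).card ≤ X * (2 * P.card) := by
  obtain ⟨a, b, h1, h2, h3⟩ := exists_generic P
  have hR := Finset.card_image_of_injective P (red_injective a b)
  have hB := Finset.card_image_of_injective P (blue_injective a b)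
  have hT : Transversal k (P.image (red a b)) (P.image (blue a b)) := by
    constructor <;> simp only [Finset.forall_mem_image]
    · exact h1
    · exact fun x hx y hy hxy => h2 x hx y hy fun h => hxy (h ▸ rfl)
    · exact fun x hx y hy hxy => h3 x hx y hy fun h => hxy (h ▸ rfl)
    · intro x hx y hy hxy
      refine (Finset.card_le_card ?_).trans
        ((Finset.card_image_le (f := red a b)).trans (hk x hx y hy fun h => hxy (h ▸ rfl)))
      intro l hl
      obtain ⟨hl, hlx, hly⟩ := mem_commonInc.1 hl
      obtain ⟨z, hz, rfl⟩ := Finset.mem_image.1 hl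
      rw [inc_red_blue] at hlx hly
      exact Finset.mem_image_of_mem _ (Finset.mem_filter.2 ⟨hz, hlx, hly⟩)
    · intro x hx y hy hxy
      refine (Finset.card_le_card ?_).trans
        ((Finset.card_image_le (f := blue a b)).trans (hk x hx y hy fun h => hxy (h ▸ rfl)))
      intro l hl
      obtain ⟨hl, hlx, hly⟩ := mem_commonInc.1 hl
      obtain ⟨z, hz, rfl⟩ := Finset.mem_image.1 hl
      have hlx := (inc_red_blue _ _ _ _).1 hlx.symm
      have hly := (inc_red_blue _ _ _ _).1 hly.symm
      exact Finset.mem_image_of_mem _ (Finset.mem_filter.2 ⟨hz, hlx.symm, hly.symm⟩)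
  have hmain := card_incidences_le hX hXk hXn hD hT (by omega)
  rw [hR, hB, ← two_mul] at hmain
  refine le_trans ?_ hmain
  refine Finset.card_le_card_of_injOn (fun x => (red a b x.1, blue a b x.2)) ?_ ?_
  · intro x hx
    simp only [Finset.coe_filter, Finset.mem_product, Set.mem_ofPred_eq] at hx
    exact mem_incidences.2 ⟨Finset.mem_image_of_mem _ hx.1.1, Finset.mem_image_of_mem _ hx.1.2,
      (inc_red_blue _ _ _ _).2 hx.2⟩
  · intro x _ y _ h
    simp only [Prod.mk.injEq] at h
    exact Prod.ext (red_injective a b h.1) (blue_injective a b h.2)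

section Plane
variable {K : Type*} [Field K]

/-- The squared distance in isotropic coordinates. -/
def nd (a b : K × K) : K := (b.1 - a.1) * (b.2 - a.2)

theorem nd_comm (a b : K × K) : nd a b = nd b a := by
  unfold nd; ring

/-- The generalized circle with the given coefficients passes through `p`. -/
def OnCircle (g : K × K × K × K) (p : K × K) : Prop :=
  g.1 * (p.1 * p.2) + g.2.1 * p.1 + g.2.2.1 * p.2 + g.2.2.2 = 0

/-- The circle of squared radius `r` around `a`. -/
def circleAround (a : K × K) (r : K) : K × K × K × K :=
  (1, -a.2, -a.1, a.1 * a.2 - r)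

theorem onCircle_circleAround {a p : K × K} {r : K} :
    OnCircle (circleAround a r) p ↔ nd a p = r := by
  unfold OnCircle circleAround nd
  rw [← sub_eq_zero (b := r)]
  ring_nf

theorem circleAround_ne_zero (a : K × K) (r : K) : circleAround a r ≠ 0 := by
  simp [circleAround, Prod.ext_iff]

open Classical in
theorem card_quadratic_le_two {a b c : K} (h : ¬ (a = 0 ∧ c = 0)) (S : Finset K)
    (hS : ∀ x ∈ S, a * x ^ 2 + b * x + c = 0) : S.card ≤ 2 := by
  by_contra! hlt
  obtain ⟨x, y, z, hx, hy, hz, hxy, hxz, hyz⟩ := Finset.two_lt_card_iff.1 hlt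
  have h1 : a * (x + y) + b = 0 :=
    mul_left_cancel₀ (sub_ne_zero.2 hxy) (by linear_combination hS x hx - hS y hy)
  have h2 : a * (x + z) + b = 0 :=
    mul_left_cancel₀ (sub_ne_zero.2 hxz) (by linear_combination hS x hx - hS z hz)
  have ha : a = 0 := mul_left_cancel₀ (sub_ne_zero.2 hyz) (by linear_combination h1 - h2)
  subst ha
  have hb : b = 0 := by linear_combination h1
  exact h ⟨rfl, by linear_combination hS x hx - x * hb⟩

open Classical in
/-- Two non-concentric circles meet in at most two points. -/
theorem card_circle_inter_le {g : K × K × K × K} {a : K × K} {r : K} (hr : r ≠ 0)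
    (hg : ¬ (g.2.1 + g.1 * a.2 = 0 ∧ g.2.2.1 + g.1 * a.1 = 0)) (A : Finset (K × K)) :
    (A.filter fun c => OnCircle g c ∧ nd a c = r).card ≤ 2 := by
  have hinj : Set.InjOn (fun c : K × K => c.1 - a.1)
      (A.filter fun c => OnCircle g c ∧ nd a c = r) := by
    intro c hc c' hc' h
    simp only [Finset.coe_filter, Set.mem_ofPred_eq] at hc hc'
    unfold nd at hc hc'
    have h1 : c.1 = c'.1 := by simpa using h
    have h2 : c.1 - a.1 ≠ 0 := fun h0 => hr (by rw [← hc.2.2, h0, zero_mul])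
    refine Prod.ext h1 (mul_left_cancel₀ h2 ?_)
    linear_combination hc.2.2 - hc'.2.2 - (c'.2 - a.2) * h1
  rw [← Finset.card_image_of_injOn hinj]
  refine card_quadratic_le_two (a := g.2.1 + g.1 * a.2) (c := r * (g.2.2.1 + g.1 * a.1))
    (b := g.1 * (a.1 * a.2) + g.1 * r + g.2.1 * a.1 + g.2.2.1 * a.2 + g.2.2.2) ?_ _ ?_
  · rwa [mul_eq_zero, or_iff_right hr]
  · intro x hx
    obtain ⟨c, hc, rfl⟩ := Finset.mem_image.1 hx
    obtain ⟨-, hc, hcr⟩ := Finset.mem_filter.1 hc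
    unfold OnCircle at hc
    unfold nd at hcr
    linear_combination (c.1 - a.1) * hc - (g.1 * c.1 + g.2.2.1) * hcr

open Classical in
/-- Removing few circles, a finite set becomes poor on every circle. -/
theorem exists_poor_subset (k : ℕ) (A : Finset (K × K)) : ∃ A' ⊆ A, ∃ G : Finset (K × K × K × K),
    G.card * k ≤ A.card ∧ (∀ g ∈ G, g ≠ 0) ∧ (∀ a ∈ A, a ∉ A' → ∃ g ∈ G, OnCircle g a) ∧
    ∀ g ≠ 0, (A'.filter (OnCircle g)).card ≤ k := by
  induction A using Finset.strongInduction with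
  | H A ih =>
  by_cases hA : ∀ g ≠ 0, (A.filter (OnCircle g)).card ≤ k
  · exact ⟨A, subset_rfl, ∅, by simp, by simp, fun a h h' => absurd h h', hA⟩
  push Not at hA
  obtain ⟨g, hg, hgk⟩ := hA
  have hcard := Finset.card_filter_add_card_filter_not (s := A) (OnCircle g)
  have hss : A.filter (fun a => ¬ OnCircle g a) ⊂ A := by
    refine (Finset.filter_subset _ _).ssubset_of_ne fun h => ?_
    rw [h] at hcard
    omega
  obtain ⟨A', hA', G, hG, hG0, hcov, hpoor⟩ := ih _ hss
  refine ⟨A', hA'.trans hss.subset, insert g G, ?_, ?_, ?_, hpoor⟩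
  · have := Nat.mul_le_mul_right k (Finset.card_insert_le g G)
    rw [add_mul, one_mul] at this
    omega
  · exact fun g' hg' => (Finset.mem_insert.1 hg').elim (fun h => h ▸ hg) (hG0 g')
  · intro a ha ha'
    by_cases hga : OnCircle g a
    · exact ⟨g, Finset.mem_insert_self _ _, hga⟩
    · obtain ⟨g', hg', h⟩ := hcov a (Finset.mem_filter.2 ⟨ha, hga⟩) ha'
      exact ⟨g', Finset.mem_insert_of_mem hg', h⟩

open Classical in
/-- Isosceles triangles with a base vertex on a given circle. -/
theorem card_triangles_onCircle_le {g : K × K × K × K} (hg : g ≠ 0) (A : Finset (K × K)) :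
    ((A ×ˢ A ×ˢ A).filter fun t => OnCircle g t.2.2 ∧ nd t.1 t.2.1 = nd t.1 t.2.2 ∧
      nd t.1 t.2.1 ≠ 0).card ≤ 3 * A.card ^ 2 := by
  obtain ⟨Z, hZ⟩ : ∃ Z, Z = A.filter fun a => g.2.1 + g.1 * a.2 = 0 ∧ g.2.2.1 + g.1 * a.1 = 0 :=
    ⟨_, rfl⟩
  rcases (A.filter (OnCircle g)).eq_empty_or_nonempty with he | ⟨c, hc⟩
  · rw [Finset.card_eq_zero.2]
    · exact Nat.zero_le _
    · refine Finset.filter_eq_empty_iff.2 fun t ht h => ?_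
      simp only [Finset.mem_product] at ht
      exact Finset.filter_eq_empty_iff.1 he ht.2.2 h.1
  have hZ1 : Z.card ≤ 1 := by
    rw [Finset.card_le_one]
    intro a ha b hb
    rw [hZ, Finset.mem_filter] at ha hb
    obtain ⟨-, ha1, ha2⟩ := ha
    obtain ⟨-, hb1, hb2⟩ := hb
    by_cases h0 : g.1 = 0
    · have hc := (Finset.mem_filter.1 hc).2
      unfold OnCircle at hc
      simp only [h0, zero_mul, add_zero, zero_add] at ha1 ha2 hc
      simp only [ha1, ha2, zero_mul, zero_add] at hc
      exact absurd (Prod.ext h0 (Prod.ext ha1 (Prod.ext ha2 hc))) hg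
    · exact Prod.ext (mul_left_cancel₀ h0 (by linear_combination ha2 - hb2))
        (mul_left_cancel₀ h0 (by linear_combination ha1 - hb1))
  have hsub : ((A ×ˢ A ×ˢ A).filter fun t => OnCircle g t.2.2 ∧ nd t.1 t.2.1 = nd t.1 t.2.2 ∧
      nd t.1 t.2.1 ≠ 0) ⊆ Z ×ˢ A ×ˢ A ∪ (A ×ˢ A ×ˢ A).filter fun t => t.1 ∉ Z ∧ OnCircle g t.2.2 ∧
        nd t.1 t.2.1 = nd t.1 t.2.2 ∧ nd t.1 t.2.1 ≠ 0 := by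
    intro t ht
    simp only [Finset.mem_union, Finset.mem_filter, Finset.mem_product] at ht ⊢
    tauto
  have h1 := (Finset.card_le_card hsub).trans (Finset.card_union_le _ _)
  have h2 : ((A ×ˢ A ×ˢ A).filter fun t => t.1 ∉ Z ∧ OnCircle g t.2.2 ∧
        nd t.1 t.2.1 = nd t.1 t.2.2 ∧ nd t.1 t.2.1 ≠ 0).card ≤ 2 * (A ×ˢ A).card := by
    refine Finset.card_le_mul_card_image_of_maps_to (f := fun t => (t.1, t.2.1)) ?_ 2 ?_
    · intro t ht
      simp only [Finset.mem_filter, Finset.mem_product] at ht ⊢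
      exact ⟨ht.1.1, ht.1.2.1⟩
    · rintro ⟨a, b⟩ hab
      by_cases hgood : a ∉ Z ∧ nd a b ≠ 0
      · have hng : ¬ (g.2.1 + g.1 * a.2 = 0 ∧ g.2.2.1 + g.1 * a.1 = 0) := fun h =>
          hgood.1 (hZ ▸ Finset.mem_filter.2 ⟨(Finset.mem_product.1 hab).1, h⟩)
        refine le_trans ?_ (card_circle_inter_le hgood.2 hng A)
        refine Finset.card_le_card_of_injOn (fun t => t.2.2) ?_ ?_
        · rintro ⟨a', b', c'⟩ ht
          simp only [Finset.coe_filter, Finset.mem_filter, Finset.mem_product, Set.mem_ofPred_eq,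
            Prod.mk.injEq] at ht ⊢
          obtain ⟨⟨⟨_, _, h3⟩, _, h4, h5, _⟩, rfl, rfl⟩ := ht
          exact ⟨h3, h4, h5.symm⟩
        · rintro ⟨a', b', c'⟩ ht ⟨a'', b'', c''⟩ ht' h
          simp only [Finset.coe_filter, Set.mem_ofPred_eq, Prod.mk.injEq] at ht ht' h
          obtain ⟨-, rfl, rfl⟩ := ht
          obtain ⟨-, rfl, rfl⟩ := ht'
          rw [h]
      · rw [Finset.card_eq_zero.2]
        · exact Nat.zero_le _
        · refine Finset.filter_eq_empty_iff.2 ?_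
          rintro ⟨a', b', c'⟩ ht h
          simp only [Prod.mk.injEq] at h
          obtain ⟨rfl, rfl⟩ := h
          simp only [Finset.mem_filter] at ht
          exact hgood ⟨ht.2.1, ht.2.2.2.2⟩
  simp only [Finset.card_product] at h1 h2
  have h3 := Nat.mul_le_mul_right (A.card * A.card) hZ1
  nlinarith

open Classical in
/-- The pairs of points of `A` at distance `r`. -/
noncomputable def pairsAt (A : Finset (K × K)) (r : K) : Finset ((K × K) × (K × K)) :=
  (A ×ˢ A).filter fun x => nd x.1 x.2 = r

theorem mem_pairsAt {A : Finset (K × K)} {r : K} {x : (K × K) × (K × K)} :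
    x ∈ pairsAt A r ↔ x.1 ∈ A ∧ x.2 ∈ A ∧ nd x.1 x.2 = r := by
  simp [pairsAt, and_assoc]

open Classical in
/-- Triples with two equal sides of squared length `r`. -/
noncomputable def cherries (A : Finset (K × K)) (r : K) :
    Finset ((K × K) × (K × K) × (K × K)) :=
  (A ×ˢ A ×ˢ A).filter fun t => nd t.1 t.2.1 = r ∧ nd t.1 t.2.2 = r

theorem mem_cherries {A : Finset (K × K)} {r : K} {t : (K × K) × (K × K) × (K × K)} :
    t ∈ cherries A r ↔ (t.1 ∈ A ∧ t.2.1 ∈ A ∧ t.2.2 ∈ A) ∧ nd t.1 t.2.1 = r ∧ nd t.1 t.2.2 = r := by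
  simp [cherries]

theorem card_pairsAt_sq_le (A : Finset (K × K)) (r : K) :
    (pairsAt A r).card ^ 2 ≤ A.card * (cherries A r).card := by
  classical
  have h1 : (pairsAt A r).card = ∑ a ∈ A, (A.filter fun b => nd a b = r).card := by
    rw [pairsAt, Finset.card_filter, Finset.sum_product]
    exact Finset.sum_congr rfl fun b _ => (Finset.card_filter _ _).symm
  have h2 : (cherries A r).card = ∑ a ∈ A, (A.filter fun b => nd a b = r).card ^ 2 := by
    rw [cherries, Finset.card_filter, Finset.sum_product]
    refine Finset.sum_congr rfl fun a _ => ?_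
    rw [← Finset.card_filter, sq, ← Finset.card_product, ← Finset.filter_product]
  rw [h1, h2]
  exact sq_sum_le_card_mul_sum_sq

theorem card_cherries_le {r : K} (hr : r ≠ 0) (A : Finset (K × K)) :
    (cherries A r).card ≤ 3 * A.card ^ 2 := by
  classical
  have hsub : cherries A r ⊆ ((A ×ˢ A).image fun x => (x.1, x.2, x.2)) ∪
      (cherries A r).filter fun t => t.2.1 ≠ t.2.2 := by
    rintro ⟨a, b, c⟩ ht
    by_cases h : b = c
    · subst h
      rw [mem_cherries] at ht
      exact Finset.mem_union_left _ (Finset.mem_image.2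
        ⟨(a, b), Finset.mem_product.2 ⟨ht.1.1, ht.1.2.1⟩, rfl⟩)
    · exact Finset.mem_union_right _ (Finset.mem_filter.2 ⟨ht, h⟩)
  have h1 := (Finset.card_le_card hsub).trans (Finset.card_union_le _ _)
  have h2 := Finset.card_image_le (s := A ×ˢ A) (f := fun x => (x.1, x.2, x.2))
  have h3 : ((cherries A r).filter fun t => t.2.1 ≠ t.2.2).card ≤ 2 * (A ×ˢ A).card := by
    refine Finset.card_le_mul_card_image_of_maps_to (f := fun t => t.2) ?_ 2 ?_
    · intro t ht
      rw [Finset.mem_filter, mem_cherries] at ht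
      exact Finset.mem_product.2 ht.1.1.2
    · rintro ⟨b, c⟩ hbc
      by_cases hne : b = c
      · rw [Finset.card_eq_zero.2]
        · exact Nat.zero_le _
        · refine Finset.filter_eq_empty_iff.2 fun t ht h => ?_
          rw [Finset.mem_filter, h] at ht
          exact ht.2 hne
      · refine le_trans ?_ (card_circle_inter_le (g := circleAround c r) (a := b) hr ?_ A)
        · refine Finset.card_le_card_of_injOn (fun t => t.1) ?_ ?_
          · rintro ⟨a, b', c'⟩ ht
            simp only [Finset.coe_filter, Finset.mem_filter, Set.mem_ofPred_eq, mem_cherries,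
              onCircle_circleAround, Prod.mk.injEq] at ht ⊢
            obtain ⟨⟨⟨⟨h3, _, _⟩, h4, h5⟩, _⟩, rfl, rfl⟩ := ht
            exact ⟨h3, nd_comm _ a ▸ h5, nd_comm _ a ▸ h4⟩
          · rintro ⟨a, b', c'⟩ ht ⟨a', b'', c''⟩ ht' h
            simp only [Finset.coe_filter, Set.mem_ofPred_eq] at ht ht' h
            exact Prod.ext h (ht.2.trans ht'.2.symm)
        · rintro ⟨h4, h5⟩
          simp only [circleAround] at h4 h5
          exact hne (Prod.ext (by linear_combination h5) (by linear_combination h4))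
  rw [Finset.card_product] at h2 h3
  nlinarith

end Plane

section Segments
variable {K : Type*} [Field K]

/-- The point of three-space representing an oriented segment of squared length `r`. -/
def segPoint (r : K) (x : (K × K) × (K × K)) : K × K × K :=
  (x.1.1 / (x.2.1 - x.1.1), x.1.2, r / (x.2.1 - x.1.1))

theorem fst_ne_of_nd_ne_zero {r : K} (hr : r ≠ 0) {x : (K × K) × (K × K)} (hx : nd x.1 x.2 = r) :
    x.2.1 - x.1.1 ≠ 0 := by
  intro h
  rw [nd, h, zero_mul] at hx
  exact hr hx.symm

theorem segPoint_injOn {r : K} (hr : r ≠ 0) (A : Finset (K × K)) :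
    Set.InjOn (segPoint r) (pairsAt A r) := by
  rintro ⟨⟨u, v⟩, ⟨u', v'⟩⟩ hx ⟨⟨x, y⟩, ⟨x', y'⟩⟩ hy h
  rw [Finset.mem_coe, mem_pairsAt] at hx hy
  have hw := fst_ne_of_nd_ne_zero hr hx.2.2
  have hz := fst_ne_of_nd_ne_zero hr hy.2.2
  have hx := hx.2.2
  have hy := hy.2.2
  simp only [nd] at hx hy hw hz
  simp only [segPoint, Prod.mk.injEq] at h
  obtain ⟨h1, rfl, h3⟩ := h
  have hwz : u' - u = x' - x :=
    (mul_left_cancel₀ hr ((div_eq_div_iff hw hz).1 h3)).symm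
  rw [← hwz, div_left_inj' hw] at h1
  subst h1
  have : u' = x' := by linear_combination hwz
  subst this
  have : v' = y' := mul_left_cancel₀ hw (by linear_combination hx - hy)
  rw [this]

theorem conj_segPoint {r : K} {x : (K × K) × (K × K)} (hx : x.2.1 - x.1.1 ≠ 0) (q : K × K × K) :
    Conj (segPoint r x) q ↔
      (x.2.1 - x.1.1) * (x.1.2 - q.2.1) + x.1.1 * q.2.2 - r * q.1 = 0 := by
  unfold Conj segPoint
  field_simp
  rw [mul_zero]

theorem eq_of_nd_eq {r : K} (hr : r ≠ 0) {a b c : K × K} (hb : nd a b = r) (hc : nd a c = r)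
    (h : b.1 = c.1) : b = c := by
  refine Prod.ext h (mul_left_cancel₀ (fst_ne_of_nd_ne_zero hr (x := (a, b)) hb) ?_)
  simp only [nd] at *
  linear_combination hb - hc - (c.2 - a.2) * h

open Classical in
/-- In a set which is poor on circles, few segments are conjugate to two given points. -/
theorem card_common_conj_le {A : Finset (K × K)} {k : ℕ}
    (hA : ∀ g ≠ 0, (A.filter (OnCircle g)).card ≤ k) {r : K} (hr : r ≠ 0) {q q' : K × K × K}
    (hq : q.2.2 ≠ 0) (hqq : q ≠ q') :
    ((pairsAt A r).filter fun x => Conj (segPoint r x) q ∧ Conj (segPoint r x) q').card ≤ k := by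
  obtain ⟨S, hS⟩ : ∃ S, S = (pairsAt A r).filter fun x =>
    Conj (segPoint r x) q ∧ Conj (segPoint r x) q' := ⟨_, rfl⟩
  have hmem : ∀ x ∈ S, x.1 ∈ A ∧ x.2 ∈ A ∧ nd x.1 x.2 = r ∧ x.2.1 - x.1.1 ≠ 0 ∧
      (x.2.1 - x.1.1) * (x.1.2 - q.2.1) + x.1.1 * q.2.2 - r * q.1 = 0 ∧
      (x.2.1 - x.1.1) * (x.1.2 - q'.2.1) + x.1.1 * q'.2.2 - r * q'.1 = 0 := by
    intro x hx
    rw [hS, Finset.mem_filter, mem_pairsAt] at hx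
    obtain ⟨⟨h1, h2, h3⟩, h4, h5⟩ := hx
    have hw := fst_ne_of_nd_ne_zero hr h3
    exact ⟨h1, h2, h3, hw, (conj_segPoint hw q).1 h4, (conj_segPoint hw q').1 h5⟩
  rw [← hS]
  have of_fst : ∀ g ≠ 0, (∀ x ∈ S, OnCircle g x.1) →
      (∀ x ∈ S, ∀ y ∈ S, x.1 = y.1 → x.2.1 = y.2.1) → S.card ≤ k := by
    intro g hg h1 h2
    refine le_trans (Finset.card_le_card_of_injOn Prod.fst ?_ ?_) (hA g hg)
    · intro x hx
      exact Finset.mem_coe.2 (Finset.mem_filter.2 ⟨(hmem x hx).1, h1 x hx⟩)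
    · intro x hx y hy hxy
      refine Prod.ext hxy (eq_of_nd_eq hr (hmem x hx).2.2.1 ?_ (h2 x hx y hy hxy))
      rw [hxy]
      exact (hmem y hy).2.2.1
  obtain ⟨X, Y, Z⟩ := q
  obtain ⟨X', Y', Z'⟩ := q'
  simp only at hq hmem
  by_cases hν : Y' - Y = 0
  · have hY : Y' = Y := sub_eq_zero.1 hν
    subst hY
    have hlin : ∀ x ∈ S, x.1.1 * (Z - Z') = r * (X - X') := fun x hx => by
      obtain ⟨-, -, -, -, h1, h2⟩ := hmem x hx
      linear_combination h1 - h2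
    by_cases hμ : Z - Z' = 0
    · rcases S.eq_empty_or_nonempty with he | ⟨x, hx⟩
      · simp [he]
      · have := hlin x hx
        rw [hμ, mul_zero] at this
        have hX := (mul_eq_zero.1 this.symm).resolve_left hr
        exact absurd (by rw [sub_eq_zero.1 hX, sub_eq_zero.1 hμ]) hqq
    obtain ⟨u, hu⟩ : ∃ u, u = r * (X - X') / (Z - Z') := ⟨_, rfl⟩
    have hu : ∀ x ∈ S, x.1.1 = u := fun x hx => by
      rw [hu, eq_div_iff hμ]; exact hlin x hx
    by_cases h0 : r * X - u * Z = 0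
    · have hfix : ∀ x ∈ S, x.1 = (u, Y') := fun x hx => by
        obtain ⟨-, -, -, hw, h1, -⟩ := hmem x hx
        refine Prod.ext (hu x hx) (sub_eq_zero.1 (mul_left_cancel₀ hw ?_))
        simp only
        linear_combination h1 + h0 - Z * hu x hx
      refine le_trans (Finset.card_le_card_of_injOn Prod.snd ?_ ?_)
        (hA (circleAround (u, Y') r) (circleAround_ne_zero _ _))
      · intro x hx
        refine Finset.mem_coe.2 (Finset.mem_filter.2 ⟨(hmem x hx).2.1, ?_⟩)
        rw [onCircle_circleAround, ← hfix x hx]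
        exact (hmem x hx).2.2.1
      · intro x hx y hy hxy
        exact Prod.ext ((hfix x hx).trans (hfix y hy).symm) hxy
    · refine of_fst (0, 1, 0, -u) (by simp [Prod.ext_iff]) ?_ ?_
      · intro x hx
        simp only [OnCircle]
        linear_combination hu x hx
      · intro x hx y hy hxy
        obtain ⟨-, -, -, hw, h1, -⟩ := hmem x hx
        obtain ⟨-, -, -, hw', h1', -⟩ := hmem y hy
        rw [← hxy] at h1'
        have hv : x.1.2 - Y' ≠ 0 := by
          intro h
          refine h0 ?_
          linear_combination -h1 + (x.2.1 - x.1.1) * h + Z * hu x hx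
        refine mul_right_cancel₀ hv ?_
        linear_combination h1 - h1'
  · have hw : ∀ x ∈ S,
        (x.2.1 - x.1.1) * (Y' - Y) = r * (X - X') - x.1.1 * (Z - Z') := fun x hx => by
      obtain ⟨-, -, -, -, h1, h2⟩ := hmem x hx
      linear_combination h1 - h2
    refine of_fst (-(Z - Z'), (Z - Z') * Y + (Y' - Y) * Z, r * (X - X'),
      -(r * (X - X')) * Y - (Y' - Y) * r * X) ?_ ?_ ?_
    · intro h
      simp only [Prod.mk_eq_zero] at h
      obtain ⟨h1, h2, -, -⟩ := h
      have h3 : (Y' - Y) * Z = 0 := by linear_combination h2 + Y * h1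
      exact (mul_ne_zero hν hq) h3
    · intro x hx
      obtain ⟨-, -, -, -, h1, -⟩ := hmem x hx
      simp only [OnCircle]
      linear_combination (Y' - Y) * h1 - (x.1.2 - Y) * hw x hx
    · intro x hx y hy hxy
      have h1 := hw x hx
      have h2 := hw y hy
      rw [← hxy] at h2
      refine mul_right_cancel₀ hν ?_
      linear_combination h1 - h2

/-- The characteristic is not among the first `D` positive integers. -/
theorem natCast_ne_zero_of_lt {D : ℕ} (h : ∀ p : ℕ, p ≠ 0 → CharP K p → D < p) :
    ∀ j : ℕ, 1 ≤ j → j ≤ D → (j : K) ≠ 0 := by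
  intro j h1 hj h0
  have hdvd := (ringChar.spec K j).1 h0
  have hne : ringChar K ≠ 0 := by
    intro h
    rw [h, zero_dvd_iff] at hdvd
    omega
  have := h _ hne (ringChar.charP K)
  have := Nat.le_of_dvd (by omega) hdvd
  omega

open Classical in
/-- Pairs of conjugate segments of the same length, in a set which is poor on circles. -/
theorem card_conj_segments_le [Infinite K] {A : Finset (K × K)} {k : ℕ}
    (hchar : ∀ p : ℕ, p ≠ 0 → CharP K p → A.card ^ 3 ≤ p ^ 4)
    (hA : ∀ g ≠ 0, (A.filter (OnCircle g)).card ≤ k) {r : K} (hr : r ≠ 0) :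
    ((pairsAt A r ×ˢ pairsAt A r).filter fun x =>
      Conj (segPoint r x.1) (segPoint r x.2)).card ≤
      (8 * k + 430 * ((pairsAt A r).card.sqrt + 1)) * (2 * (pairsAt A r).card) := by
  obtain ⟨P, hP⟩ : ∃ P, P = (pairsAt A r).image (segPoint r) := ⟨_, rfl⟩
  have hPcard : P.card = (pairsAt A r).card := by
    rw [hP, Finset.card_image_of_injOn (segPoint_injOn hr A)]
  rw [← hPcard]
  obtain ⟨s, hs⟩ : ∃ s, s = P.card.sqrt := ⟨_, rfl⟩
  have hs1 : s * s ≤ P.card := hs ▸ Nat.sqrt_le _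
  have hs2 : P.card < (s + 1) * (s + 1) := hs ▸ Nat.lt_succ_sqrt _
  rw [← hs]
  have hX : 92160 * (2 * P.card) ≤ (8 * k + 430 * (s + 1)) ^ 2 :=
    calc 92160 * (2 * P.card) ≤ (430 * (s + 1)) ^ 2 := by linarith
      _ ≤ _ := Nat.pow_le_pow_left (by omega) 2
  refine le_trans ?_ (card_conj_le (K := K) (k := k) (P := P) (by omega) (by omega) hX
    (natCast_ne_zero_of_lt fun p hp hpc => ?_) ?_)
  · refine Finset.card_le_card_of_injOn (fun x => (segPoint r x.1, segPoint r x.2)) ?_ ?_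
    · intro x hx
      simp only [Finset.coe_filter, Finset.mem_product, Set.mem_ofPred_eq] at hx ⊢
      rw [hP]
      exact ⟨⟨Finset.mem_image_of_mem _ hx.1.1, Finset.mem_image_of_mem _ hx.1.2⟩, hx.2⟩
    · intro x hx y hy h
      simp only [Finset.coe_filter, Finset.mem_product, Set.mem_ofPred_eq] at hx hy
      simp only [Prod.mk.injEq] at h
      exact Prod.ext (segPoint_injOn hr A hx.1.1 hy.1.1 h.1) (segPoint_injOn hr A hx.1.2 hy.1.2 h.2)
  · have hp2 : 2 ≤ p := by
      rcases CharP.char_is_prime_or_zero K p with h | h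
      · exact h.two_le
      · exact absurd h hp
    have hsp : s < 2 * p := by
      have h1 := card_pairsAt_sq_le A r
      have h2 := card_cherries_le hr A
      have h3 := hchar p hp hpc
      have h4 : s ^ 4 ≤ 3 * p ^ 4 := by
        calc s ^ 4 = (s * s) ^ 2 := by ring
          _ ≤ P.card ^ 2 := Nat.pow_le_pow_left hs1 2
          _ ≤ A.card * (3 * A.card ^ 2) := by
            rw [hPcard]; exact h1.trans (Nat.mul_le_mul_left _ h2)
          _ = 3 * A.card ^ 3 := by ring
          _ ≤ _ := by omega
      by_contra! hcon
      have h5 := Nat.pow_le_pow_left hcon 4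
      have h6 : 0 < p ^ 4 := by positivity
      rw [mul_pow] at h5
      omega
    have h1 : 24 * (2 * P.card) / (8 * k + 430 * (s + 1)) ≤ (s + 1) / 8 := by
      rw [Nat.le_div_iff_mul_le (by norm_num)]
      have h2 := Nat.div_mul_le_self (24 * (2 * P.card)) (8 * k + 430 * (s + 1))
      obtain ⟨t, ht⟩ : ∃ t, t = 24 * (2 * P.card) / (8 * k + 430 * (s + 1)) := ⟨_, rfl⟩
      rw [← ht] at h2 ⊢
      refine Nat.le_of_mul_le_mul_right (c := s + 1) ?_ (by omega)
      nlinarith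
    omega
  · rw [hP]
    simp only [Finset.forall_mem_image]
    intro x hx y hy hxy
    have hq : (segPoint r x).2.2 ≠ 0 :=
      div_ne_zero hr (fst_ne_of_nd_ne_zero hr (mem_pairsAt.1 hx).2.2)
    refine le_trans ?_ (card_common_conj_le hA hr hq hxy)
    rw [Finset.filter_image]
    exact Finset.card_image_le

end Segments

section Bisectors
variable {K : Type*} [Field K]

/-- Coefficients of the perpendicular bisector of a segment. -/
def axis (x : (K × K) × (K × K)) : K × K :=
  ((x.2.1 - x.1.1) / (x.1.2 - x.2.2), x.2.1 - (x.2.1 - x.1.1) / (x.1.2 - x.2.2) * x.1.2)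

theorem axis_spec {x : (K × K) × (K × K)} (hx : nd x.1 x.2 ≠ 0) :
    (axis x).1 ≠ 0 ∧ x.2.1 = (axis x).1 * x.1.2 + (axis x).2 ∧
      x.1.1 = (axis x).1 * x.2.2 + (axis x).2 := by
  have h1 : x.2.1 - x.1.1 ≠ 0 := left_ne_zero_of_mul hx
  have h2 : x.1.2 - x.2.2 ≠ 0 := by
    rw [← neg_sub]; exact neg_ne_zero.2 (right_ne_zero_of_mul hx)
  have h3 : (axis x).1 * (x.1.2 - x.2.2) = x.2.1 - x.1.1 := div_mul_cancel₀ _ h2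
  have h4 : (axis x).2 = x.2.1 - (axis x).1 * x.1.2 := rfl
  refine ⟨div_ne_zero h1 h2, ?_, ?_⟩
  · linear_combination -h4
  · linear_combination -h4 + h3

theorem mem_axis_of_nd_eq {a : K × K} {x : (K × K) × (K × K)} (hx : nd x.1 x.2 ≠ 0)
    (h : nd a x.1 = nd a x.2) : a.1 = (axis x).1 * a.2 + (axis x).2 := by
  obtain ⟨-, h1, h2⟩ := axis_spec hx
  have h3 : x.1.2 - x.2.2 ≠ 0 := by
    rw [← neg_sub]; exact neg_ne_zero.2 (right_ne_zero_of_mul hx)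
  refine mul_right_cancel₀ h3 ?_
  unfold nd at h
  linear_combination -h + (x.1.2 - a.2) * h2 - (x.2.2 - a.2) * h1

open Classical in
/-- The non-isotropic pairs of points. -/
noncomputable def segments (A : Finset (K × K)) : Finset ((K × K) × (K × K)) :=
  (A ×ˢ A).filter fun x => nd x.1 x.2 ≠ 0

theorem mem_segments {A : Finset (K × K)} {x : (K × K) × (K × K)} :
    x ∈ segments A ↔ x.1 ∈ A ∧ x.2 ∈ A ∧ nd x.1 x.2 ≠ 0 := by
  simp [segments, and_assoc]

open Classical in
/-- The pairs of segments with a common perpendicular bisector. -/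
noncomputable def coaxial (A : Finset (K × K)) :
    Finset (((K × K) × (K × K)) × ((K × K) × (K × K))) :=
  (segments A ×ˢ segments A).filter fun x => axis x.1 = axis x.2

theorem mem_coaxial {A : Finset (K × K)} {x : ((K × K) × (K × K)) × ((K × K) × (K × K))} :
    x ∈ coaxial A ↔ x.1 ∈ segments A ∧ x.2 ∈ segments A ∧ axis x.1 = axis x.2 := by
  simp [coaxial, and_assoc]

open Classical in
/-- Apices of isosceles triangles, counted through coaxial pairs of bases. -/
theorem exists_sq_le_card_coaxial_mul (A A' : Finset (K × K)) : ∃ S : ℕ,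
    ((A ×ˢ segments A').filter fun t => nd t.1 t.2.1 = nd t.1 t.2.2).card ≤
      (segments A').card + S ∧ S ^ 2 ≤ (coaxial A').card * A.card ^ 2 := by
  let L : K × K → Finset (K × K) := fun κ => A.filter fun a => a.1 = κ.1 * a.2 + κ.2
  let m : K × K → ℕ := fun κ => ((segments A').filter fun x => axis x = κ).card
  let T := (segments A').image axis
  refine ⟨∑ κ ∈ T, m κ * ((L κ).card - 1), ?_, ?_⟩
  · have h1 : ((A ×ˢ segments A').filter fun t => nd t.1 t.2.1 = nd t.1 t.2.2).card ≤
        ∑ x ∈ segments A', (L (axis x)).card := by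
      rw [Finset.card_filter, Finset.sum_product_right]
      refine Finset.sum_le_sum fun x hx => ?_
      rw [← Finset.card_filter]
      refine Finset.card_le_card fun a ha => ?_
      rw [Finset.mem_filter] at ha ⊢
      exact ⟨ha.1, mem_axis_of_nd_eq (mem_segments.1 hx).2.2 ha.2⟩
    have h2 : ∑ x ∈ segments A', ((L (axis x)).card - 1) = ∑ κ ∈ T, m κ * ((L κ).card - 1) := by
      rw [Finset.sum_comp (fun κ => (L κ).card - 1) axis]
      exact Finset.sum_congr rfl fun κ _ => smul_eq_mul _ _
    rw [← h2, Finset.card_eq_sum_ones (segments A'), ← Finset.sum_add_distrib]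
    exact h1.trans (Finset.sum_le_sum fun x _ => by omega)
  · have h1 : (coaxial A').card = ∑ κ ∈ T, m κ ^ 2 := by
      rw [Finset.card_eq_sum_card_fiberwise (f := fun x => axis x.1) (t := T)]
      · refine Finset.sum_congr rfl fun κ _ => ?_
        rw [sq, ← Finset.card_product]
        congr 1
        ext x
        simp only [Finset.mem_filter, Finset.mem_product, mem_coaxial]
        constructor
        · rintro ⟨⟨h1, h2, h3⟩, h4⟩
          exact ⟨⟨h1, h4⟩, h2, h3 ▸ h4⟩
        · rintro ⟨⟨h1, h4⟩, h2, h3⟩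
          exact ⟨⟨h1, h2, h4.trans h3.symm⟩, h4⟩
      · intro x hx
        exact Finset.mem_coe.2 (Finset.mem_image_of_mem _ (mem_coaxial.1 hx).1)
    have h2 : ∑ κ ∈ T, ((L κ).card - 1) ^ 2 ≤ A.card ^ 2 := by
      have h3 : ∀ κ ∈ T, ((L κ).card - 1) ^ 2 ≤ (L κ).offDiag.card := by
        intro κ _
        rw [Finset.offDiag_card]
        rcases Nat.eq_zero_or_pos (L κ).card with h | h
        · simp [h]
        · obtain ⟨n, hn⟩ : ∃ n, (L κ).card = n + 1 := ⟨_, (Nat.succ_pred_eq_of_pos h).symm⟩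
          rw [hn]
          have : (n + 1) * (n + 1) - (n + 1) = (n + 1) * n := by
            rw [Nat.mul_succ]; omega
          rw [this, Nat.add_sub_cancel]
          nlinarith
      refine (Finset.sum_le_sum h3).trans ?_
      rw [← Finset.card_biUnion, sq, ← Finset.card_product]
      · refine Finset.card_le_card fun x hx => ?_
        obtain ⟨κ, -, hx⟩ := Finset.mem_biUnion.1 hx
        obtain ⟨h4, h5, -⟩ := Finset.mem_offDiag.1 hx
        exact Finset.mem_product.2 ⟨(Finset.mem_filter.1 h4).1, (Finset.mem_filter.1 h5).1⟩
      · intro κ _ κ' _ hne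
        rw [Function.onFun, Finset.disjoint_left]
        intro x hx hx'
        obtain ⟨h4, h5, h6⟩ := Finset.mem_offDiag.1 hx
        obtain ⟨h4', h5', -⟩ := Finset.mem_offDiag.1 hx'
        have e1 := (Finset.mem_filter.1 h4).2
        have e2 := (Finset.mem_filter.1 h5).2
        have e3 := (Finset.mem_filter.1 h4').2
        have e4 := (Finset.mem_filter.1 h5').2
        have hv : x.1.2 - x.2.2 ≠ 0 := by
          intro h
          refine h6 (Prod.ext ?_ (sub_eq_zero.1 h))
          linear_combination e1 - e2 + κ.1 * h
        have hα : κ.1 = κ'.1 := mul_right_cancel₀ hv (by linear_combination e3 - e4 - e1 + e2)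
        exact hne (Prod.ext hα (by linear_combination e3 - e1 - x.1.2 * hα))
    rw [h1]
    exact (Finset.sum_mul_sq_le_sq_mul_sq _ _ _).trans (Nat.mul_le_mul_left _ h2)

open Classical in
theorem card_pairsAt_zero_le {A : Finset (K × K)} {k : ℕ}
    (hA : ∀ g ≠ 0, (A.filter (OnCircle g)).card ≤ k) :
    (pairsAt A 0).card ≤ k * A.card := by
  refine Finset.card_le_mul_card_image_of_maps_to (f := Prod.fst) ?_ k ?_
  · exact fun x hx => (mem_pairsAt.1 hx).1
  · intro a _
    refine le_trans ?_ (hA (circleAround a 0) (circleAround_ne_zero _ _))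
    refine Finset.card_le_card_of_injOn Prod.snd ?_ ?_
    · intro x hx
      simp only [Finset.coe_filter, Set.mem_ofPred_eq, mem_pairsAt, onCircle_circleAround] at hx ⊢
      exact ⟨hx.1.2.1, hx.2 ▸ hx.1.2.2⟩
    · intro x hx y hy h
      simp only [Finset.coe_filter, Set.mem_ofPred_eq] at hx hy
      exact Prod.ext (hx.2.trans hy.2.symm) h

/-- Coaxial segments have corresponding endpoints at equal distances. -/
theorem nd_eq_of_axis_eq {x y : (K × K) × (K × K)} (hx : nd x.1 x.2 ≠ 0) (hy : nd y.1 y.2 ≠ 0)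
    (h : axis x = axis y) : nd x.1 y.1 = nd x.2 y.2 := by
  obtain ⟨-, h1, h2⟩ := axis_spec hx
  obtain ⟨-, h3, h4⟩ := axis_spec hy
  rw [← h] at h3 h4
  unfold nd
  rw [h1, h2, h3, h4]
  ring

theorem conj_of_axis_eq {x y : (K × K) × (K × K)} (hx : nd x.1 x.2 ≠ 0) (hy : nd y.1 y.2 ≠ 0)
    (h : axis x = axis y) {r : K} (hr : r ≠ 0) (hxy : nd x.1 y.1 = r) :
    Conj (segPoint r (x.1, y.1)) (segPoint r (x.2, y.2)) := by
  have hxy' := (nd_eq_of_axis_eq hx hy h).symm.trans hxy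
  have hw := fst_ne_of_nd_ne_zero hr (x := (x.1, y.1)) hxy
  have hz := fst_ne_of_nd_ne_zero hr (x := (x.2, y.2)) hxy'
  rw [conj_segPoint hw]
  obtain ⟨-, h1, h2⟩ := axis_spec hx
  obtain ⟨-, h3, h4⟩ := axis_spec hy
  rw [← h] at h3 h4
  have hz' : y.2.1 - x.2.1 = (axis x).1 * (y.1.2 - x.1.2) := by rw [h1, h3]; ring
  have hu : x.2.1 - x.1.1 = (axis x).1 * (x.1.2 - x.2.2) := by rw [h1, h2]; ring
  unfold nd at hxy
  simp only [segPoint] at hw hz ⊢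
  refine mul_right_cancel₀ hz ?_
  rw [zero_mul, sub_mul, add_mul, mul_div_assoc', mul_div_assoc', div_mul_cancel₀ _ hz,
    div_mul_cancel₀ _ hz, hz']
  linear_combination (axis x).1 * (x.1.2 - x.2.2) * hxy - r * hu

end Bisectors

section Counting
variable {K : Type*} [Field K]

open Classical in
/-- The non-degenerate isosceles triangles in isotropic coordinates. -/
noncomputable def triangles (A : Finset (K × K)) : Finset ((K × K) × (K × K) × (K × K)) :=
  (A ×ˢ A ×ˢ A).filter fun t => nd t.1 t.2.1 = nd t.1 t.2.2 ∧ nd t.2.1 t.2.2 ≠ 0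

theorem mem_triangles {A : Finset (K × K)} {t : (K × K) × (K × K) × (K × K)} :
    t ∈ triangles A ↔ (t.1 ∈ A ∧ t.2.1 ∈ A ∧ t.2.2 ∈ A) ∧ nd t.1 t.2.1 = nd t.1 t.2.2 ∧
      nd t.2.1 t.2.2 ≠ 0 := by
  simp [triangles]

theorem triangles_mono {A A' : Finset (K × K)} (h : A' ⊆ A) : triangles A' ⊆ triangles A := by
  intro t ht
  rw [mem_triangles] at ht ⊢
  exact ⟨⟨h ht.1.1, h ht.1.2.1, h ht.1.2.2⟩, ht.2⟩

theorem sum_card_cherries_le (A : Finset (K × K)) {T : Finset K} (hT : ∀ r ∈ T, r ≠ 0) :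
    ∑ r ∈ T, (cherries A r).card ≤ (triangles A).card + A.card ^ 2 := by
  classical
  rw [← Finset.card_biUnion]
  · have hsub : T.biUnion (cherries A) ⊆
        triangles A ∪ (A ×ˢ A).image fun x => (x.1, x.2, x.2) := by
      rintro ⟨a, b, c⟩ ht
      obtain ⟨r, hr, ht⟩ := Finset.mem_biUnion.1 ht
      obtain ⟨⟨ha, hb, hc⟩, h1, h2⟩ := mem_cherries.1 ht
      simp only at ha hb hc h1 h2
      by_cases hbc : nd b c = 0
      · refine Finset.mem_union_right _ (Finset.mem_image.2
          ⟨(a, b), Finset.mem_product.2 ⟨ha, hb⟩, ?_⟩)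
        have : b = c := by
          rcases mul_eq_zero.1 hbc with h | h
          · exact eq_of_nd_eq (hT r hr) h1 h2 (sub_eq_zero.1 h).symm
          · have hb2 : b.2 - a.2 ≠ 0 := right_ne_zero_of_mul (h1.trans_ne (hT r hr))
            refine Prod.ext (mul_right_cancel₀ hb2 ?_) (sub_eq_zero.1 h).symm
            unfold nd at h1 h2
            linear_combination h1 - h2 + (c.1 - a.1) * h
        rw [this]
      · exact Finset.mem_union_left _ (mem_triangles.2 ⟨⟨ha, hb, hc⟩, h1.trans h2.symm, hbc⟩)
    refine (Finset.card_le_card hsub).trans ((Finset.card_union_le _ _).trans ?_)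
    have := Finset.card_image_le (s := A ×ˢ A) (f := fun x => (x.1, x.2, x.2))
    rw [Finset.card_product, ← sq] at this
    omega
  · intro r _ r' _ hne
    rw [Function.onFun, Finset.disjoint_left]
    intro t ht ht'
    exact hne ((mem_cherries.1 ht).2.1.symm.trans (mem_cherries.1 ht').2.1)

open Classical in
/-- Coaxial pairs of segments whose corresponding endpoints are at distance zero. -/
theorem card_coaxial_zero_le {A : Finset (K × K)} {k : ℕ}
    (hA : ∀ g ≠ 0, (A.filter (OnCircle g)).card ≤ k) :
    ((coaxial A).filter fun x => nd x.1.1 x.2.1 = 0).card ≤ k * A.card ^ 2 := by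
  have h : ((coaxial A).filter fun x => nd x.1.1 x.2.1 = 0).card ≤ (pairsAt A 0 ×ˢ A).card := by
    refine Finset.card_le_card_of_injOn (fun x => ((x.1.1, x.2.1), x.1.2)) ?_ ?_
    · intro x hx
      simp only [Finset.coe_filter, Set.mem_ofPred_eq, mem_coaxial, mem_segments] at hx
      obtain ⟨⟨⟨h1, h2, -⟩, ⟨h3, -, -⟩, -⟩, h4⟩ := hx
      exact Finset.mem_coe.2 (Finset.mem_product.2 ⟨mem_pairsAt.2 ⟨h1, h3, h4⟩, h2⟩)
    · rintro ⟨⟨b, c⟩, ⟨b', c'⟩⟩ hx ⟨⟨x, y⟩, ⟨x', y'⟩⟩ hy h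
      simp only [Finset.coe_filter, Set.mem_ofPred_eq, mem_coaxial, mem_segments] at hx hy
      simp only [Prod.mk.injEq] at h
      obtain ⟨⟨rfl, rfl⟩, rfl⟩ := h
      obtain ⟨⟨-, ⟨-, -, h2⟩, h3⟩, -⟩ := hx
      obtain ⟨⟨-, ⟨-, -, h5⟩, h6⟩, -⟩ := hy
      obtain ⟨ha, e1, e2⟩ := axis_spec (x := (b', c')) h2
      obtain ⟨-, e3, e4⟩ := axis_spec (x := (b', y')) h5
      rw [← h6, h3] at e3 e4
      simp only at e1 e2 e3 e4
      have : c' = y' := Prod.ext (by linear_combination e1 - e3)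
        (mul_left_cancel₀ ha (by linear_combination e4 - e2))
      rw [this]
  rw [Finset.card_product] at h
  have := Nat.mul_le_mul_right A.card (card_pairsAt_zero_le hA)
  nlinarith

open Classical in
/-- Coaxial pairs of segments in a set which is poor on circles. -/
theorem exists_card_coaxial_le [Infinite K] {A : Finset (K × K)} {k : ℕ}
    (hchar : ∀ p : ℕ, p ≠ 0 → CharP K p → A.card ^ 3 ≤ p ^ 4)
    (hA : ∀ g ≠ 0, (A.filter (OnCircle g)).card ≤ k) : ∃ S : ℕ,
    (coaxial A).card ≤ (17 * k + 860) * A.card ^ 2 + 860 * S ∧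
      S ^ 2 ≤ A.card ^ 3 * ((triangles A).card + A.card ^ 2) := by
  obtain ⟨T, hTdef⟩ : ∃ T, T = ((A ×ˢ A).image fun x => nd x.1 x.2).erase 0 := ⟨_, rfl⟩
  have hT : ∀ r ∈ T, r ≠ 0 := fun r hr => (Finset.mem_erase.1 (hTdef ▸ hr)).1
  let M : K → ℕ := fun r => (pairsAt A r).card
  have hM : ∑ r ∈ T, M r ≤ A.card ^ 2 := by
    rw [← Finset.card_biUnion, sq, ← Finset.card_product]
    · refine Finset.card_le_card fun x hx => ?_
      obtain ⟨r, -, hx⟩ := Finset.mem_biUnion.1 hx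
      exact Finset.mem_product.2 ⟨(mem_pairsAt.1 hx).1, (mem_pairsAt.1 hx).2.1⟩
    · intro r _ r' _ hne
      rw [Function.onFun, Finset.disjoint_left]
      intro t ht ht'
      exact hne ((mem_pairsAt.1 ht).2.2.symm.trans (mem_pairsAt.1 ht').2.2)
  have hM2 : ∑ r ∈ T, M r ^ 2 ≤ A.card * ((triangles A).card + A.card ^ 2) := by
    refine (Finset.sum_le_sum fun r _ => card_pairsAt_sq_le A r).trans ?_
    rw [← Finset.mul_sum]
    exact Nat.mul_le_mul_left _ (sum_card_cherries_le A hT)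
  refine ⟨∑ r ∈ T, M r * (M r).sqrt, ?_, ?_⟩
  · have h0 := card_coaxial_zero_le hA
    have h1 : ((coaxial A).filter fun x => ¬ nd x.1.1 x.2.1 = 0).card ≤
        ∑ r ∈ T, (8 * k + 430 * ((M r).sqrt + 1)) * (2 * M r) := by
      rw [Finset.card_eq_sum_card_fiberwise (f := fun x => nd x.1.1 x.2.1) (t := T)]
      · refine Finset.sum_le_sum fun r hr => ?_
        refine le_trans ?_ (card_conj_segments_le hchar hA (hT r hr))
        refine Finset.card_le_card_of_injOn (fun x => ((x.1.1, x.2.1), (x.1.2, x.2.2))) ?_ ?_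
        · intro x hx
          simp only [Finset.coe_filter, Set.mem_ofPred_eq, Finset.mem_filter, mem_coaxial,
            mem_segments, Finset.mem_product, mem_pairsAt] at hx ⊢
          obtain ⟨⟨⟨⟨h1, h2, h3⟩, ⟨h4, h5, h6⟩, h7⟩, -⟩, h8⟩ := hx
          exact ⟨⟨⟨h1, h4, h8⟩, h2, h5, (nd_eq_of_axis_eq h3 h6 h7).symm.trans h8⟩,
            conj_of_axis_eq h3 h6 h7 (hT r hr) h8⟩
        · rintro ⟨⟨b, c⟩, ⟨b', c'⟩⟩ - ⟨⟨x, y⟩, ⟨x', y'⟩⟩ - h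
          simp only [Prod.mk.injEq] at h
          obtain ⟨⟨rfl, rfl⟩, rfl, rfl⟩ := h
          rfl
      · intro x hx
        simp only [Finset.coe_filter, Set.mem_ofPred_eq, mem_coaxial, mem_segments] at hx
        rw [hTdef]
        exact Finset.mem_coe.2 (Finset.mem_erase.2 ⟨hx.2, Finset.mem_image.2
          ⟨(x.1.1, x.2.1), Finset.mem_product.2 ⟨hx.1.1.1, hx.1.2.1.1⟩, rfl⟩⟩)
    have h2 : ∑ r ∈ T, (8 * k + 430 * ((M r).sqrt + 1)) * (2 * M r) =
        (16 * k + 860) * ∑ r ∈ T, M r + 860 * ∑ r ∈ T, M r * (M r).sqrt := by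
      rw [Finset.mul_sum, Finset.mul_sum, ← Finset.sum_add_distrib]
      exact Finset.sum_congr rfl fun r _ => by ring
    have h3 := Nat.mul_le_mul_left (16 * k + 860) hM
    rw [← Finset.card_filter_add_card_filter_not
      (fun x : ((K × K) × (K × K)) × ((K × K) × (K × K)) => nd x.1.1 x.2.1 = 0)]
    nlinarith
  · have h1 : (∑ r ∈ T, M r * (M r).sqrt) ^ 2 ≤
        (∑ r ∈ T, M r) * ∑ r ∈ T, M r * (M r).sqrt ^ 2 :=
      Finset.sum_sq_le_sum_mul_sum_of_sq_le_mul _ (fun _ _ => Nat.zero_le _)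
        (fun _ _ => Nat.zero_le _) fun r _ => le_of_eq (by ring)
    have h2 : ∑ r ∈ T, M r * (M r).sqrt ^ 2 ≤ ∑ r ∈ T, M r ^ 2 :=
      Finset.sum_le_sum fun r _ => by
        rw [sq (M r)]
        exact Nat.mul_le_mul_left _ (Nat.sqrt_le' _)
    calc _ ≤ _ := h1
      _ ≤ A.card ^ 2 * (A.card * ((triangles A).card + A.card ^ 2)) :=
        Nat.mul_le_mul hM (h2.trans hM2)
      _ = _ := by ring

open Classical in
/-- Isosceles triangles with sides of squared length zero. -/
theorem card_triangles_zero_le (A : Finset (K × K)) :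
    ((triangles A).filter fun t => nd t.1 t.2.1 = 0).card ≤ 2 * A.card ^ 2 := by
  rw [sq, ← Finset.card_product]
  refine Finset.card_le_mul_card_image_of_maps_to (f := fun t => t.2) ?_ 2 ?_
  · intro t ht
    rw [Finset.mem_filter, mem_triangles] at ht
    exact Finset.mem_product.2 ht.1.1.2
  · rintro ⟨b, c⟩ -
    refine le_trans (Finset.card_le_card (t := {((b.1, c.2), b, c), ((c.1, b.2), b, c)}) ?_)
      Finset.card_le_two
    rintro ⟨a, b', c'⟩ ht
    simp only [Finset.mem_filter, mem_triangles, Prod.mk.injEq] at ht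
    obtain ⟨⟨⟨-, h1, h2⟩, h3⟩, rfl, rfl⟩ := ht
    rw [h3] at h1
    simp only [Finset.mem_insert, Finset.mem_singleton, Prod.mk.injEq, and_true]
    unfold nd at h1 h2 h3
    rcases mul_eq_zero.1 h3 with h | h <;> rcases mul_eq_zero.1 h1.symm with h' | h'
    · exact absurd (by linear_combination (c'.2 - b'.2) * (h' - h)) h2
    · exact Or.inl (Prod.ext (by linear_combination -h) (by linear_combination -h'))
    · exact Or.inr (Prod.ext (by linear_combination -h') (by linear_combination -h))
    · exact absurd (by linear_combination (c'.1 - b'.1) * (h' - h)) h2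

open Classical in
theorem exists_card_triangles_le [Infinite K] {A : Finset (K × K)} (k : ℕ)
    (hchar : ∀ p : ℕ, p ≠ 0 → CharP K p → A.card ^ 3 ≤ p ^ 4) : ∃ J E S S' : ℕ,
    J * k ≤ A.card ∧ (triangles A).card ≤ (3 + 6 * J) * A.card ^ 2 + S' ∧
      S' ^ 2 ≤ E * A.card ^ 2 ∧ E ≤ (17 * k + 860) * A.card ^ 2 + 860 * S ∧
      S ^ 2 ≤ A.card ^ 3 * ((triangles A).card + A.card ^ 2) := by
  obtain ⟨A', hA', G, hG, hG0, hcov, hpoor⟩ := exists_poor_subset k A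
  have hcard := Finset.card_le_card hA'
  obtain ⟨S', hS', hS'sq⟩ := exists_sq_le_card_coaxial_mul A A'
  obtain ⟨S, hS, hSsq⟩ := exists_card_coaxial_le
    (fun p hp h => (Nat.pow_le_pow_left hcard 3).trans (hchar p hp h)) hpoor
  have hsq : A'.card ^ 2 ≤ A.card ^ 2 := Nat.pow_le_pow_left hcard 2
  refine ⟨G.card, (coaxial A').card, S, S', hG, ?_, hS'sq, hS.trans (by gcongr), hSsq.trans ?_⟩
  · let C : K × K × K × K → Finset ((K × K) × (K × K) × (K × K)) := fun g =>
      (A ×ˢ A ×ˢ A).filter fun t => OnCircle g t.2.2 ∧ nd t.1 t.2.1 = nd t.1 t.2.2 ∧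
        nd t.1 t.2.1 ≠ 0
    have hC : (G.biUnion C).card ≤ G.card * (3 * A.card ^ 2) :=
      Finset.card_biUnion_le_card_mul _ _ _ fun g hg => card_triangles_onCircle_le (hG0 g hg) A
    have hseg : (segments A').card ≤ A.card ^ 2 := by
      refine (Finset.card_filter_le _ _).trans ?_
      rw [Finset.card_product, ← sq]
      exact hsq
    have hsub : triangles A ⊆ ((triangles A).filter fun t => nd t.1 t.2.1 = 0) ∪
        (G.biUnion C ∪ (G.biUnion C).image fun t => (t.1, t.2.2, t.2.1)) ∪
        (A ×ˢ segments A').filter fun t => nd t.1 t.2.1 = nd t.1 t.2.2 := by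
      rintro ⟨a, b, c⟩ ht
      obtain ⟨⟨ha, hb, hc⟩, h1, h2⟩ := mem_triangles.1 ht
      simp only at ha hb hc h1 h2
      by_cases h0 : nd a b = 0
      · exact Finset.mem_union_left _ (Finset.mem_union_left _ (Finset.mem_filter.2 ⟨ht, h0⟩))
      by_cases hc' : c ∈ A'
      · by_cases hb' : b ∈ A'
        · exact Finset.mem_union_right _ (Finset.mem_filter.2
            ⟨Finset.mem_product.2 ⟨ha, mem_segments.2 ⟨hb', hc', h2⟩⟩, h1⟩)
        · obtain ⟨g, hg, hgb⟩ := hcov b hb hb'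
          refine Finset.mem_union_left _ (Finset.mem_union_right _ (Finset.mem_union_right _
            (Finset.mem_image.2 ⟨(a, c, b), Finset.mem_biUnion.2 ⟨g, hg, ?_⟩, rfl⟩)))
          simp only [C, Finset.mem_filter, Finset.mem_product]
          exact ⟨⟨ha, hc, hb⟩, hgb, h1.symm, h1 ▸ h0⟩
      · obtain ⟨g, hg, hgc⟩ := hcov c hc hc'
        refine Finset.mem_union_left _ (Finset.mem_union_right _ (Finset.mem_union_left _
          (Finset.mem_biUnion.2 ⟨g, hg, ?_⟩)))
        simp only [C, Finset.mem_filter, Finset.mem_product]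
        exact ⟨⟨ha, hb, hc⟩, hgc, h1, h0⟩
    have h1 := (Finset.card_le_card hsub).trans (Finset.card_union_le _ _)
    have h2 := Finset.card_union_le ((triangles A).filter fun t => nd t.1 t.2.1 = 0)
      (G.biUnion C ∪ (G.biUnion C).image fun t => (t.1, t.2.2, t.2.1))
    have h3 := Finset.card_union_le (G.biUnion C) ((G.biUnion C).image fun t => (t.1, t.2.2, t.2.1))
    have h4 := Finset.card_image_le (s := G.biUnion C) (f := fun t => (t.1, t.2.2, t.2.1))
    have h5 := card_triangles_zero_le A
    have h6 : (3 + 6 * G.card) * A.card ^ 2 =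
      3 * A.card ^ 2 + 2 * (G.card * (3 * A.card ^ 2)) := by ring
    omega
  · have := Finset.card_le_card (triangles_mono hA')
    gcongr

end Counting

/-- The inequalities between the counts, solved for the number `T` of triangles. -/
theorem le_of_count_inequalities {n T S S' E J k : ℝ} (hn : 1 ≤ n) (hJ0 : 0 ≤ J)
    (hk1 : n ^ 2 ≤ k) (hk2 : k ≤ 2 * n ^ 2) (hJ : J * k ≤ n ^ 3)
    (hT : T ≤ (3 + 6 * J) * n ^ 6 + S') (hS' : S' ^ 2 ≤ E * n ^ 6)
    (hE : E ≤ (17 * k + 860) * n ^ 6 + 860 * S) (hS : S ^ 2 ≤ n ^ 9 * (T + n ^ 6)) :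
    T ≤ 500 * n ^ 7 := by
  by_contra! h
  have hn0 : 0 < n := one_pos.trans_le hn
  have hn7 : 0 < n ^ 7 := pow_pos hn0 7
  have hTpos : 0 < T := (by positivity : 0 < 500 * n ^ 7).trans h
  have hJn : J ≤ n := by
    refine le_of_mul_le_mul_right ?_ (pow_pos hn0 2)
    calc J * n ^ 2 ≤ J * k := by gcongr
      _ ≤ n ^ 3 := hJ
      _ = n * n ^ 2 := by ring
  have h67 : n ^ 6 ≤ n ^ 7 := pow_le_pow_right₀ hn (by norm_num)
  have hlow : T / 2 ≤ S' := by
    have : J * n ^ 6 ≤ n ^ 7 := by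
      calc J * n ^ 6 ≤ n * n ^ 6 := by gcongr
        _ = n ^ 7 := by ring
    linarith
  have hE' : E ≤ 894 * n ^ 8 + 860 * S := by
    have h1 : k * n ^ 6 ≤ 2 * n ^ 8 := by
      calc k * n ^ 6 ≤ 2 * n ^ 2 * n ^ 6 := by gcongr
        _ = _ := by ring
    have h2 : n ^ 6 ≤ n ^ 8 := pow_le_pow_right₀ hn (by norm_num)
    linarith
  have hsq : (T / 2) ^ 2 ≤ 894 * (n ^ 7) ^ 2 + 860 * (n ^ 6 * S) := by
    calc (T / 2) ^ 2 ≤ S' ^ 2 := by gcongr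
      _ ≤ E * n ^ 6 := hS'
      _ ≤ (894 * n ^ 8 + 860 * S) * n ^ 6 := by gcongr
      _ = _ := by ring
  have hT2 : T ^ 2 ≤ 6880 * (n ^ 6 * S) := by
    have : (500 * n ^ 7) ^ 2 ≤ T ^ 2 := by gcongr
    nlinarith
  have hT4 : T ^ 3 * T ≤ 2 * 6880 ^ 2 * n ^ 21 * T := by
    calc T ^ 3 * T = (T ^ 2) ^ 2 := by ring
      _ ≤ (6880 * (n ^ 6 * S)) ^ 2 := by gcongr
      _ = 6880 ^ 2 * n ^ 12 * S ^ 2 := by ring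
      _ ≤ 6880 ^ 2 * n ^ 12 * (n ^ 9 * (T + n ^ 6)) := by gcongr
      _ ≤ 6880 ^ 2 * n ^ 12 * (n ^ 9 * (T + T)) := by gcongr; linarith
      _ = _ := by ring
  have hT3 := le_of_mul_le_mul_right hT4 hTpos
  have : (500 * n ^ 7) ^ 3 ≤ T ^ 3 := by gcongr
  have : 0 < n ^ 21 := pow_pos hn0 21
  nlinarith

/-- The isosceles triangle bound for the form `nd` over an infinite field. -/
theorem card_triangles_le {K : Type*} [Field K] [Infinite K] {A : Finset (K × K)}
    (hchar : ∀ p : ℕ, p ≠ 0 → CharP K p → A.card ^ 3 ≤ p ^ 4) :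
    ((triangles A).card : ℝ) ≤ 500 * (A.card : ℝ) ^ ((7 : ℝ) / 3) := by
  rcases A.eq_empty_or_nonempty with rfl | hne
  · have : triangles (∅ : Finset (K × K)) = ∅ := by
      refine Finset.eq_empty_of_forall_notMem fun t ht => ?_
      simpa using (mem_triangles.1 ht).1.1
    rw [this, Finset.card_empty, Nat.cast_zero]
    positivity
  have hN : (1 : ℝ) ≤ A.card := by exact_mod_cast hne.card_pos
  obtain ⟨n, hn, hnN⟩ : ∃ n : ℝ, 1 ≤ n ∧ (A.card : ℝ) = n ^ 3 :=
    ⟨(A.card : ℝ) ^ ((1 : ℝ) / 3), Real.one_le_rpow hN (by norm_num), by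
      rw [← Real.rpow_mul_natCast (by positivity)]; norm_num⟩
  have hn0 : 0 ≤ n := zero_le_one.trans hn
  have h7 : (A.card : ℝ) ^ ((7 : ℝ) / 3) = n ^ 7 := by
    rw [hnN, ← Real.rpow_natCast n 3, ← Real.rpow_mul hn0, ← Real.rpow_natCast]
    norm_num
  obtain ⟨J, E, S, S', hJ, hT, hS', hE, hS⟩ := exists_card_triangles_le ⌈n ^ 2⌉₊ hchar
  have hk : (⌈n ^ 2⌉₊ : ℝ) ≤ 2 * n ^ 2 := by
    have := Nat.ceil_lt_add_one (sq_nonneg n)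
    nlinarith
  rify at hJ hT hS' hE hS
  rw [h7]
  rw [hnN] at hJ hT hS' hE hS
  ring_nf at hT hS' hE hS
  refine le_of_count_inequalities (S := S) (S' := S') (E := E) (J := J) hn
    (Nat.cast_nonneg _) (Nat.le_ceil _) hk hJ ?_ ?_ ?_ ?_ <;> linarith

/-- The linear change of coordinates which turns `dist2` into `nd`, given a root `i` of `-1`. -/
def isotropic {F K : Type*} [Field F] [Field K] [Algebra F K] (i : K) (x : F × F) : K × K :=
  (algebraMap F K x.1 + i * algebraMap F K x.2, algebraMap F K x.1 - i * algebraMap F K x.2)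

theorem nd_isotropic {F K : Type*} [Field F] [Field K] [Algebra F K] {i : K} (hi : i ^ 2 = -1)
    (x y : F × F) : nd (isotropic i x) (isotropic i y) = algebraMap F K (dist2 x y) := by
  simp only [nd, isotropic, dist2, map_add, map_pow, map_sub]
  linear_combination -(algebraMap F K y.2 - algebraMap F K x.2) ^ 2 * hi

theorem isotropic_injective {F K : Type*} [Field F] [Field K] [Algebra F K] {i : K}
    (hi : i ^ 2 = -1) (h2 : (2 : K) ≠ 0) :
    Function.Injective (isotropic i : F × F → K × K) := by
  intro x y h
  obtain ⟨h1, h1'⟩ := Prod.ext_iff.1 h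
  simp only [isotropic] at h1 h1'
  have hi0 : i ≠ 0 := by
    rintro rfl
    simp at hi
  refine Prod.ext ((algebraMap F K).injective (mul_left_cancel₀ h2 ?_))
    ((algebraMap F K).injective (mul_left_cancel₀ (mul_ne_zero h2 hi0) ?_))
  · linear_combination h1 + h1'
  · linear_combination h1 - h1'

theorem dot_sub_self {F : Type*} [CommRing F] (b c : F × F) :
    dot (b - c) (b - c) = dist2 b c := by
  simp only [dot, dist2, Prod.fst_sub, Prod.snd_sub]
  ring

theorem Tstar_eq_zero {F : Type*} [CommRing F] (h2 : (2 : F) = 0) (A : Finset (F × F)) :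
    Tstar A = 0 := by
  refine (congrArg Set.ncard (Set.eq_empty_of_forall_notMem ?_)).trans (Set.ncard_empty _)
  rintro ⟨a, b, c⟩ ⟨-, -, -, h, hne⟩
  refine hne ?_
  rw [dot_sub_self]
  unfold dist2 at h ⊢
  simp only at h ⊢
  linear_combination h + (-b.1 * c.1 + a.1 * b.1 - a.1 * c.1 + c.1 ^ 2
    - b.2 * c.2 + a.2 * b.2 - a.2 * c.2 + c.2 ^ 2) * h2

open Classical in
theorem Tstar_le_card_triangles {F K : Type*} [Field F] [Field K] [Algebra F K] {i : K}
    (hi : i ^ 2 = -1) (h2 : (2 : K) ≠ 0) (A : Finset (F × F)) :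
    Tstar A ≤ (triangles (A.image (isotropic i : F × F → K × K))).card := by
  have hinj := isotropic_injective (F := F) hi h2
  rw [← Set.ncard_coe_finset]
  refine Set.ncard_le_ncard_of_injOn
    (fun t => (isotropic i t.1, isotropic i t.2.1, isotropic i t.2.2)) ?_ ?_
    (Finset.finite_toSet _)
  · rintro ⟨a, b, c⟩ ⟨ha, hb, hc, h, hne⟩
    rw [dot_sub_self] at hne
    refine Finset.mem_coe.2 (mem_triangles.2 ⟨⟨Finset.mem_image_of_mem _ ha,
      Finset.mem_image_of_mem _ hb, Finset.mem_image_of_mem _ hc⟩, ?_, ?_⟩)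
    · rw [nd_isotropic hi, nd_isotropic hi, h]
    · rw [nd_isotropic hi]
      exact (map_ne_zero _).2 hne
  · rintro ⟨a, b, c⟩ - ⟨a', b', c'⟩ - h
    simp only [Prod.mk.injEq] at h
    rw [hinj h.1, hinj h.2.1, hinj h.2.2]

/-- Isosceles-triangle bound over a general field: there is an absolute constant `C > 0` such
that for every field `F` and finite `A ⊆ F²` (with `|A| ≤ p^(4/3)` if `char F = p > 0`),
`T*(A) ≤ C·|A|^(7/3)`. -/
theorem isosceles_triangle_bound_general_field :
    ∃ C : ℝ, 0 < C ∧
      ∀ (F : Type) [inst : Field F],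
        ∀ A : Finset (F × F),
          (∀ p : ℕ, p ≠ 0 → CharP F p → (A.card : ℝ) ≤ (p : ℝ) ^ ((4 : ℝ) / 3)) →
          (Tstar A : ℝ) ≤ C * (A.card : ℝ) ^ ((7 : ℝ) / 3) := by
  classical
  refine ⟨500, by norm_num, fun F _ A hA => ?_⟩
  by_cases h2 : (2 : F) = 0
  · rw [Tstar_eq_zero h2, Nat.cast_zero]
    positivity
  let K := AlgebraicClosure F
  have : Infinite K := IsAlgClosed.instInfinite
  obtain ⟨i, hi⟩ := IsAlgClosed.exists_pow_nat_eq (-1 : K) two_pos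
  have h2K : (2 : K) ≠ 0 := by
    rw [← map_ofNat (algebraMap F K) 2]
    exact (map_ne_zero _).2 h2
  have hcard : (A.image (isotropic i : F × F → K × K)).card = A.card :=
    Finset.card_image_of_injective _ (isotropic_injective hi h2K)
  rw [← hcard]
  refine le_trans (Nat.cast_le.2 (Tstar_le_card_triangles hi h2K A)) (card_triangles_le ?_)
  intro p hp hchar
  rw [hcard]
  have h := hA p hp ((algebraMap F K).charP (algebraMap F K).injective p)
  have hpow : ((p : ℝ) ^ ((4 : ℝ) / 3)) ^ 3 = (p : ℝ) ^ 4 := by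
    rw [← Real.rpow_mul_natCast (Nat.cast_nonneg p), ← Real.rpow_natCast]
    norm_num
  have h3 : (A.card : ℝ) ^ 3 ≤ (p : ℝ) ^ 4 := hpow ▸ pow_le_pow_left₀ (Nat.cast_nonneg _) h 3
  exact_mod_cast h3

end Stmt5
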